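/- Let k be an algebraically closed field of characteristic zero, p, q primes (not necessarily distinct), and D an irreducible homogeneous locally nilpotent derivation of rank 2 and degree pq−2 on k[U,V,W]. If D is not triangularizable, then there exist a linear system of variables {X,Y,Z}, γ ∈ k*, a homogeneous polynomial h(X,Y) of degree q monic in Y, and constants c₁,…,c_p ∈ k with c_p ≠ 0, such that D = γ·Δ_{(X,P)} where, setting T = h(X,Y) + X^{q−1}Z, P = T^p + c₁X^qT^{p−1} + ⋯ + c_{p−1}X^{pq−q}T + c_pX^{pq−1}Y (possibly with the roles of p and q interchanged). Moreover deg_D(Y) = p, deg_D(Z) = pq, and T is a local slice of D with D(T) = γ·c_p·X^{pq+q−2}. -/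

import Mathlib

/-- A derivation is locally nilpotent if every element is killed by some iterate. -/
def IsLND {k B : Type*} [CommRing k] [CommRing B] [Algebra k B]
    (D : Derivation k B B) : Prop :=
  ∀ b : B, ∃ n : ℕ, (⇑D)^[n] b = 0

/-- `ndeg D b n` says that `n` is the `D`-degree of `b`, i.e. the largest `m` with
`D^[m] b ≠ 0`. -/
def ndeg {k B : Type*} [CommRing k] [CommRing B] [Algebra k B]
    (D : Derivation k B B) (b : B) (n : ℕ) : Prop :=
  (⇑D)^[n] b ≠ 0 ∧ (⇑D)^[n + 1] b = 0

/-- A derivation is irreducible if the ideal generated by its image is not contained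
in any proper principal ideal. -/
def IsIrred {k B : Type*} [CommRing k] [CommRing B] [Algebra k B]
    (D : Derivation k B B) : Prop :=
  ∀ b : B, Ideal.span (Set.range (⇑D)) ≤ Ideal.span {b} → IsUnit b

open MvPolynomial

/-- The Jacobian derivation `g ↦ ∂(f₁,f₂,g)/∂(X₀,X₁,X₂)` on `k[X₀,X₁,X₂]`. -/
noncomputable def jac {k : Type*} [CommRing k]
    (f₁ f₂ g : MvPolynomial (Fin 3) k) : MvPolynomial (Fin 3) k :=
  Matrix.det (Matrix.of fun i j => MvPolynomial.pderiv j (![f₁, f₂, g] i))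

/-- `V 0, V 1, V 2` form a system of coordinates (variables) of `k[X₀,X₁,X₂]`. -/
def IsCoordSys {k : Type*} [CommRing k]
    (V : Fin 3 → MvPolynomial (Fin 3) k) : Prop :=
  ∃ σ : MvPolynomial (Fin 3) k ≃ₐ[k] MvPolynomial (Fin 3) k,
    ∀ i, σ (X i) = V i

/-- `D` is homogeneous of degree `d` with respect to the standard grading. -/
def IsHomogDer {k : Type*} [CommRing k]
    (D : Derivation k (MvPolynomial (Fin 3) k) (MvPolynomial (Fin 3) k))
    (d : ℕ) : Prop :=
  ∀ (i : ℕ) (f : MvPolynomial (Fin 3) k),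
    f.IsHomogeneous i → (D f).IsHomogeneous (i + d)

/-- `D` has rank 2: some coordinate system has its last variable in the kernel, but no
coordinate system has its last two variables in the kernel. -/
def HasRank2 {k : Type*} [CommRing k]
    (D : Derivation k (MvPolynomial (Fin 3) k) (MvPolynomial (Fin 3) k)) : Prop :=
  (∃ V : Fin 3 → MvPolynomial (Fin 3) k, IsCoordSys V ∧ D (V 2) = 0) ∧
  ¬ (∃ V : Fin 3 → MvPolynomial (Fin 3) k, IsCoordSys V ∧ D (V 1) = 0 ∧ D (V 2) = 0)

/-- `D` is triangularizable: in some coordinate system `{X,Y,Z}` one has `D X ∈ k`,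
`D Y ∈ k[X]`, `D Z ∈ k[X,Y]`. -/
def IsTriangularizable {k : Type*} [CommRing k]
    (D : Derivation k (MvPolynomial (Fin 3) k) (MvPolynomial (Fin 3) k)) : Prop :=
  ∃ V : Fin 3 → MvPolynomial (Fin 3) k, IsCoordSys V ∧
    (∃ c : k, D (V 0) = C c) ∧
    D (V 1) ∈ Algebra.adjoin k ({V 0} : Set (MvPolynomial (Fin 3) k)) ∧
    D (V 2) ∈ Algebra.adjoin k ({V 0, V 1} : Set (MvPolynomial (Fin 3) k))

/-- The normal form of Theorem 3.9: `D = γ Δ_{(X,P)}` with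
`P = T^p + c₁ X^q T^{p-1} + ⋯ + c_{p-1} X^{pq-q} T + c_p X^{pq-1} Y`,
`T = h(X,Y) + X^{q-1} Z` for a homogeneous `h` of degree `q` monic in `Y`;
moreover `deg_D Y = p`, `deg_D Z = pq` and `T` is a local slice with
`D T = γ c_p X^{pq+q-2}`. -/
def NormalForm {k : Type*} [Field k]
    (D : Derivation k (MvPolynomial (Fin 3) k) (MvPolynomial (Fin 3) k))
    (γ : k) (p q : ℕ) (V : Fin 3 → MvPolynomial (Fin 3) k) : Prop :=
  ∃ (h₀ : MvPolynomial (Fin 2) k) (c : ℕ → k),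
    h₀.IsHomogeneous q ∧
    MvPolynomial.coeff (Finsupp.single (1 : Fin 2) q) h₀ = 1 ∧
    c p ≠ 0 ∧
    letI T : MvPolynomial (Fin 3) k :=
      aeval ![V 0, V 1] h₀ + (V 0) ^ (q - 1) * V 2
    letI P : MvPolynomial (Fin 3) k :=
      T ^ p + (∑ i ∈ Finset.Icc 1 (p - 1), C (c i) * (V 0) ^ (i * q) * T ^ (p - i))
        + C (c p) * (V 0) ^ (p * q - 1) * V 1
    (∀ g, D g = C γ * jac (V 0) P g) ∧
    D (V 0) = 0 ∧
    ndeg D (V 1) p ∧ ndeg D (V 2) (p * q) ∧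
    D T = C (γ * c p) * (V 0) ^ (p * q + q - 2)


open MvPolynomial

section LNDbasics
variable {k B : Type*} [Field k] [CommRing B] [Algebra k B] (d : Derivation k B B)

theorem it_zero (n : ℕ) : (⇑d)^[n] 0 = 0 := by
  induction n with
  | zero => rfl
  | succ n ih => rw [Function.iterate_succ_apply', ih, map_zero]

theorem it_add (n : ℕ) (f g : B) : (⇑d)^[n] (f + g) = (⇑d)^[n] f + (⇑d)^[n] g := by
  induction n with
  | zero => rfl
  | succ n ih => simp only [Function.iterate_succ_apply', ih, map_add]

theorem it_ge {f : B} {m n : ℕ} (h : (⇑d)^[m] f = 0) (hmn : m ≤ n) : (⇑d)^[n] f = 0 := by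
  obtain ⟨e, rfl⟩ := Nat.exists_eq_add_of_le hmn
  rw [add_comm, Function.iterate_add_apply, h, it_zero]

theorem it_sum {ι : Type*} (s : Finset ι) (F : ι → B) (n : ℕ) :
    (⇑d)^[n] (∑ i ∈ s, F i) = ∑ i ∈ s, (⇑d)^[n] (F i) := by
  classical
  induction s using Finset.induction_on with
  | empty => simp [it_zero]
  | insert a s ha ih => rw [Finset.sum_insert ha, Finset.sum_insert ha, it_add, ih]

theorem it_const_mul {c : B} (hc : d c = 0) (n : ℕ) (f : B) :
    (⇑d)^[n] (c * f) = c * (⇑d)^[n] f := by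
  induction n with
  | zero => rfl
  | succ n ih => rw [Function.iterate_succ_apply', ih, Derivation.leibniz, hc,
      Function.iterate_succ_apply']; simp

theorem it_mul (N : ℕ) : ∀ (m n : ℕ) (f g : B), m + n = N → (⇑d)^[m + 1] f = 0 →
    (⇑d)^[n + 1] g = 0 →
    (⇑d)^[N] (f * g) = (Nat.choose N m : B) * ((⇑d)^[m] f * (⇑d)^[n] g) ∧
    (⇑d)^[N + 1] (f * g) = 0 := by
  induction N with
  | zero =>
    intro m n f g h hf hg
    obtain rfl : m = 0 := by omega
    obtain rfl : n = 0 := by omega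
    simp at hf hg ⊢
    simp [hf, hg]
  | succ N ih =>
    intro m n f g h hf hg
    have key : ∀ j, (⇑d)^[j + 1] (f * g) = (⇑d)^[j] (f * d g) + (⇑d)^[j] (d f * g) := by
      intro j
      rw [Function.iterate_succ_apply, Derivation.leibniz, it_add]
      simp [mul_comm]
    rw [key, key]
    rcases m with _ | m
    · obtain rfl : n = N + 1 := by omega
      have h0 : d f = 0 := by simpa using hf
      have := ih 0 N f (d g) (by omega) hf (by simpa [Function.iterate_succ_apply] using hg)
      rw [this.1, this.2]
      simp [h0, it_zero, Function.iterate_succ_apply]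
    · rcases n with _ | n
      · obtain rfl : m = N := by omega
        have h0 : d g = 0 := by simpa using hg
        have := ih m 0 (d f) g (by omega) (by simpa [Function.iterate_succ_apply] using hf) hg
        rw [this.1, this.2]
        simp [h0, it_zero, Function.iterate_succ_apply]
      · have h1 := ih (m+1) n f (d g) (by omega) hf
          (by simpa [Function.iterate_succ_apply] using hg)
        have h2 := ih m (n+1) (d f) g (by omega)
          (by simpa [Function.iterate_succ_apply] using hf) hg
        rw [h1.1, h1.2, h2.1, h2.2, Nat.choose_succ_succ]
        refine ⟨?_, by simp⟩
        simp only [Function.iterate_succ_apply]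
        push_cast
        ring

theorem ndeg_exists (hd : IsLND d) {f : B} (hf : f ≠ 0) : ∃ n, ndeg d f n := by
  classical
  have h := hd f
  refine ⟨Nat.find h - 1, ?_⟩
  have h0 : Nat.find h ≠ 0 := by
    intro h0
    have := Nat.find_spec h
    rw [h0] at this
    exact hf this
  refine ⟨Nat.find_min h (by omega), ?_⟩
  rw [Nat.sub_add_cancel (by omega)]
  exact Nat.find_spec h

theorem ndeg_unique {f : B} {m n : ℕ} (h : ndeg d f m) (h' : ndeg d f n) : m = n := by
  by_contra hne
  rcases Nat.lt_or_gt_of_ne hne with hl | hl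
  · exact h'.1 (it_ge d h.2 hl)
  · exact h.1 (it_ge d h'.2 hl)

theorem ndeg_add {f g : B} {n : ℕ} (h : ndeg d f n) (h' : (⇑d)^[n] g = 0) : ndeg d (f + g) n := by
  refine ⟨?_, ?_⟩
  · rw [it_add, h', add_zero]; exact h.1
  · rw [it_add, it_ge d h' (Nat.le_succ n), add_zero]; exact h.2

theorem ndeg_zero_iff {f : B} : ndeg d f 0 ↔ f ≠ 0 ∧ d f = 0 := by
  simp [ndeg]

theorem ndeg_neg {f : B} {n : ℕ} (h : ndeg d f n) : ndeg d (-f) n := by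
  have : ∀ j, (⇑d)^[j] (-f) = - (⇑d)^[j] f := by
    intro j
    have := it_const_mul d (c := -1) (by simp) j f
    simpa using this
  refine ⟨?_, ?_⟩
  · rw [this]; exact neg_ne_zero.2 h.1
  · rw [this, h.2, neg_zero]

variable [IsDomain B] [CharZero k]

theorem ndeg_mul {f g : B} {m n : ℕ} (hf : ndeg d f m) (hg : ndeg d g n) :
    ndeg d (f * g) (m + n) := by
  have : CharZero B := charZero_of_injective_algebraMap (algebraMap k B).injective
  have h := it_mul d (m + n) m n f g rfl hf.2 hg.2
  refine ⟨?_, h.2⟩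
  rw [h.1]
  refine mul_ne_zero ?_ (mul_ne_zero hf.1 hg.1)
  exact_mod_cast (Nat.choose_pos (by omega)).ne'

theorem ndeg_pow {f : B} {m : ℕ} (hf : ndeg d f m) (n : ℕ) : ndeg d (f ^ n) (n * m) := by
  induction n with
  | zero => simp [ndeg]
  | succ n ih => rw [pow_succ, Nat.succ_mul]; exact ndeg_mul d ih hf

theorem fact_closed (hd : IsLND d) {f g : B} (hfg : f * g ≠ 0) (h : d (f * g) = 0) : d f = 0 := by
  obtain ⟨m, hm⟩ := ndeg_exists d hd (left_ne_zero_of_mul hfg)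
  obtain ⟨n, hn⟩ := ndeg_exists d hd (right_ne_zero_of_mul hfg)
  have := ndeg_unique d (ndeg_mul d hm hn) ((ndeg_zero_iff d).2 ⟨hfg, h⟩)
  obtain rfl : m = 0 := by omega
  exact ((ndeg_zero_iff d).1 hm).2

theorem fact_closed_dvd (hd : IsLND d) {f g : B} (hfg : f ∣ g) (hg : g ≠ 0) (h : d g = 0) :
    d f = 0 := by
  obtain ⟨e, rfl⟩ := hfg
  exact fact_closed d hd hg h

theorem ndeg_of_d {f : B} {m : ℕ} (h : ndeg d f m) (hf : d f ≠ 0) :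
    1 ≤ m ∧ ndeg d (d f) (m - 1) := by
  rcases m with _ | m
  · exact absurd ((ndeg_zero_iff d).1 h).2 hf
  · exact ⟨by omega, by simpa [ndeg, Function.iterate_succ_apply] using h⟩

end LNDbasics

open MvPolynomial

section Gr
variable {k : Type*} [Field k]

/-- all monomials occurring in `f` satisfy `Q` -/
def Sp (Q : (Fin 2 →₀ ℕ) → Prop) (f : MvPolynomial (Fin 2) k) : Prop :=
  ∀ m, coeff m f ≠ 0 → Q m

theorem Sp_mono {P Q : (Fin 2 →₀ ℕ) → Prop} (h : ∀ m, P m → Q m) {f : MvPolynomial (Fin 2) k}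
    (hf : Sp P f) : Sp Q f := fun m hm => h m (hf m hm)

theorem Sp_zero (Q : (Fin 2 →₀ ℕ) → Prop) : Sp Q (0 : MvPolynomial (Fin 2) k) := by
  intro m hm; simp at hm

theorem Sp_add {Q : (Fin 2 →₀ ℕ) → Prop} {f g : MvPolynomial (Fin 2) k}
    (hf : Sp Q f) (hg : Sp Q g) : Sp Q (f + g) := by
  intro m hm
  by_cases h : coeff m f = 0
  · exact hg m (by intro h'; simp [h, h'] at hm)
  · exact hf m h

theorem Sp_neg {Q : (Fin 2 →₀ ℕ) → Prop} {f : MvPolynomial (Fin 2) k}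
    (hf : Sp Q f) : Sp Q (-f) := by
  intro m hm
  exact hf m (by simpa using hm)

theorem Sp_sub {Q : (Fin 2 →₀ ℕ) → Prop} {f g : MvPolynomial (Fin 2) k}
    (hf : Sp Q f) (hg : Sp Q g) : Sp Q (f - g) := by
  rw [sub_eq_add_neg]; exact Sp_add hf (Sp_neg hg)

theorem Sp_sum {Q : (Fin 2 →₀ ℕ) → Prop} {ι : Type*} (s : Finset ι)
    (F : ι → MvPolynomial (Fin 2) k) (h : ∀ i ∈ s, Sp Q (F i)) : Sp Q (∑ i ∈ s, F i) := by
  classical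
  induction s using Finset.induction_on with
  | empty => simpa using Sp_zero Q
  | insert a s ha ih =>
    rw [Finset.sum_insert ha]
    exact Sp_add (h a (by simp)) (ih fun i hi => h i (by simp [hi]))

theorem Sp_mul {P Q R : (Fin 2 →₀ ℕ) → Prop} (h : ∀ m n, P m → Q n → R (m + n))
    {f g : MvPolynomial (Fin 2) k} (hf : Sp P f) (hg : Sp Q g) : Sp R (f * g) := by
  classical
  intro m hm
  rw [coeff_mul] at hm
  obtain ⟨x, hx, hx'⟩ := Finset.exists_ne_zero_of_sum_ne_zero hm
  rw [Finset.HasAntidiagonal.mem_antidiagonal] at hx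
  rw [← hx]
  exact h _ _ (hf _ (left_ne_zero_of_mul hx')) (hg _ (right_ne_zero_of_mul hx'))

theorem Sp_pderiv {P R : (Fin 2 →₀ ℕ) → Prop} (i : Fin 2)
    (h : ∀ m, P (m + Finsupp.single i 1) → R m)
    {f : MvPolynomial (Fin 2) k} (hf : Sp P f) : Sp R (pderiv i f) := by
  intro m hm
  rw [coeff_pderiv] at hm
  exact h m (hf _ (left_ne_zero_of_mul hm))

theorem Sp_monomial {Q : (Fin 2 →₀ ℕ) → Prop} {m : Fin 2 →₀ ℕ} (h : Q m) (c : k) :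
    Sp Q (monomial m c) := by
  classical
  intro n hn
  rw [coeff_monomial] at hn
  split_ifs at hn with h'
  · exact h' ▸ h
  · exact absurd rfl hn

theorem Sp_split (P Q R : (Fin 2 →₀ ℕ) → Prop) (h : ∀ m, P m → ¬ Q m → R m)
    {f : MvPolynomial (Fin 2) k} (hf : Sp P f) : ∃ g, Sp Q g ∧ Sp R (f - g) := by
  classical
  refine ⟨∑ m ∈ f.support.filter Q, monomial m (coeff m f), ?_, ?_⟩
  · exact Sp_sum _ _ fun m hm => Sp_monomial (Finset.mem_filter.1 hm).2 _
  · have : f - ∑ m ∈ f.support.filter Q, monomial m (coeff m f) =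
        ∑ m ∈ f.support.filter (fun m => ¬ Q m), monomial m (coeff m f) := by
      rw [sub_eq_iff_eq_add, add_comm, Finset.sum_filter_add_sum_filter_not]
      exact f.as_sum
    rw [this]
    refine Sp_sum _ _ fun m hm => Sp_monomial ?_ _
    rw [Finset.mem_filter, mem_support_iff] at hm
    exact h m (hf m hm.1) hm.2

theorem Sp_false {Q : (Fin 2 →₀ ℕ) → Prop} (h : ∀ m, ¬ Q m) {f : MvPolynomial (Fin 2) k}
    (hf : Sp Q f) : f = 0 := by
  ext m
  by_contra hm
  exact h m (hf m (by simpa using hm))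

theorem Sp_and {P Q : (Fin 2 →₀ ℕ) → Prop} {f : MvPolynomial (Fin 2) k}
    (hf : Sp P f) (hg : Sp Q f) : Sp (fun m => P m ∧ Q m) f := fun m hm => ⟨hf m hm, hg m hm⟩

/-- weight of a monomial -/
def wt (a b : ℤ) (m : Fin 2 →₀ ℕ) : ℤ := a * m 0 + b * m 1

theorem wt_add (a b : ℤ) (m n : Fin 2 →₀ ℕ) : wt a b (m + n) = wt a b m + wt a b n := by
  simp [wt]; ring

/-- weighted degree at most `n` -/
def Le (a b n : ℤ) (f : MvPolynomial (Fin 2) k) : Prop := Sp (fun m => wt a b m ≤ n) f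

/-- weighted homogeneous of degree `n` -/
def Hm (a b n : ℤ) (f : MvPolynomial (Fin 2) k) : Prop := Sp (fun m => wt a b m = n) f

variable {a b : ℤ}

theorem Le_zero (n : ℤ) : Le a b n (0 : MvPolynomial (Fin 2) k) := Sp_zero _

theorem Le_neg {n : ℤ} {f : MvPolynomial (Fin 2) k} (h : Le a b n f) : Le a b n (-f) := Sp_neg h

theorem Hm_monomial (m : Fin 2 →₀ ℕ) (c : k) : Hm a b (wt a b m) (monomial m c) :=
  Sp_monomial (Q := fun m' => wt a b m' = wt a b m) rfl c

theorem Le_mul {m n : ℤ} {f g : MvPolynomial (Fin 2) k} (hf : Le a b m f) (hg : Le a b n g) :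
    Le a b (m + n) (f * g) :=
  Sp_mul (fun x y hx hy => by rw [wt_add]; exact add_le_add hx hy) hf hg

theorem Hm_mul {m n : ℤ} {f g : MvPolynomial (Fin 2) k} (hf : Hm a b m f) (hg : Hm a b n g) :
    Hm a b (m + n) (f * g) :=
  Sp_mul (fun x y hx hy => by rw [wt_add, hx, hy]) hf hg

theorem Hm_Le {n : ℤ} {f : MvPolynomial (Fin 2) k} (hf : Hm a b n f) : Le a b n f :=
  Sp_mono (fun _ h => h.le) hf

theorem Hm_C (c : k) : Hm a b 0 (C c : MvPolynomial (Fin 2) k) :=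
  Sp_monomial (by simp [wt]) c

theorem Hm_pow {m : ℤ} {f : MvPolynomial (Fin 2) k} (hf : Hm a b m f) (n : ℕ) :
    Hm a b (n * m) (f ^ n) := by
  induction n with
  | zero => simpa using Hm_C (a := a) (b := b) (1 : k)
  | succ n ih =>
    rw [pow_succ]
    have := Hm_mul ih hf
    push_cast
    rwa [add_mul, one_mul]

theorem Le_pow {m : ℤ} {f : MvPolynomial (Fin 2) k} (hf : Le a b m f) (n : ℕ) :
    Le a b (n * m) (f ^ n) := by
  induction n with
  | zero => simpa using Hm_Le (Hm_C (a := a) (b := b) (1 : k))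
  | succ n ih =>
    rw [pow_succ]
    have := Le_mul ih hf
    push_cast
    rwa [add_mul, one_mul]

theorem Hm_X0 : Hm a b a (X 0 : MvPolynomial (Fin 2) k) := Sp_monomial (by simp [wt]) 1
theorem Hm_X1 : Hm a b b (X 1 : MvPolynomial (Fin 2) k) := Sp_monomial (by simp [wt]) 1

theorem Le_mono {m n : ℤ} (h : m ≤ n) {f : MvPolynomial (Fin 2) k} (hf : Le a b m f) :
    Le a b n f := Sp_mono (fun _ h' => le_trans h' h) hf

theorem Hm_Le_zero {m n : ℤ} (h : n < m) {f : MvPolynomial (Fin 2) k} (hf : Hm a b m f)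
    (hf' : Le a b n f) : f = 0 :=
  Sp_false (fun _ h' => by have := h'.1; have := h'.2; omega) (Sp_and hf hf')

theorem Le_split {n : ℤ} {f : MvPolynomial (Fin 2) k} (hf : Le a b n f) :
    ∃ g, Hm a b n g ∧ Le a b (n - 1) (f - g) :=
  Sp_split _ _ _ (fun m h h' => by omega) hf

theorem der_eq (d : Derivation k (MvPolynomial (Fin 2) k) (MvPolynomial (Fin 2) k))
    (f : MvPolynomial (Fin 2) k) :
    d f = pderiv 0 f * d (X 0) + pderiv 1 f * d (X 1) := by
  have : d = d (X 0) • pderiv 0 + d (X 1) • pderiv 1 := by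
    apply derivation_ext
    intro i
    fin_cases i <;> simp
  conv_lhs => rw [this]
  simp [mul_comm]

theorem Le_d {d : Derivation k (MvPolynomial (Fin 2) k) (MvPolynomial (Fin 2) k)} {e : ℤ}
    (h0 : Le a b (a + e) (d (X 0))) (h1 : Le a b (b + e) (d (X 1))) {n : ℤ}
    {f : MvPolynomial (Fin 2) k} (hf : Le a b n f) : Le a b (n + e) (d f) := by
  rw [der_eq]
  have p0 : Le a b (n - a) (pderiv 0 f) :=
    Sp_pderiv 0 (fun m h => by rw [wt_add] at h; simp [wt] at h ⊢; omega) hf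
  have p1 : Le a b (n - b) (pderiv 1 f) :=
    Sp_pderiv 1 (fun m h => by rw [wt_add] at h; simp [wt] at h ⊢; omega) hf
  refine Sp_add ?_ ?_
  · have := Le_mul p0 h0
    rwa [show n - a + (a + e) = n + e by ring] at this
  · have := Le_mul p1 h1
    rwa [show n - b + (b + e) = n + e by ring] at this

theorem Hm_d {d : Derivation k (MvPolynomial (Fin 2) k) (MvPolynomial (Fin 2) k)} {e : ℤ}
    (h0 : Hm a b (a + e) (d (X 0))) (h1 : Hm a b (b + e) (d (X 1))) {n : ℤ}
    {f : MvPolynomial (Fin 2) k} (hf : Hm a b n f) : Hm a b (n + e) (d f) := by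
  rw [der_eq]
  have p0 : Hm a b (n - a) (pderiv 0 f) :=
    Sp_pderiv 0 (fun m h => by rw [wt_add] at h; simp [wt] at h ⊢; omega) hf
  have p1 : Hm a b (n - b) (pderiv 1 f) :=
    Sp_pderiv 1 (fun m h => by rw [wt_add] at h; simp [wt] at h ⊢; omega) hf
  refine Sp_add ?_ ?_
  · have := Hm_mul p0 h0
    rwa [show n - a + (a + e) = n + e by ring] at this
  · have := Hm_mul p1 h1
    rwa [show n - b + (b + e) = n + e by ring] at this

/-- existence of some bound -/
theorem Le_exists (a b : ℤ) (f : MvPolynomial (Fin 2) k) : ∃ n, Le a b n f := by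
  classical
  refine ⟨∑ m ∈ f.support, |wt a b m|, fun m hm => ?_⟩
  exact (le_abs_self _).trans (Finset.single_le_sum (f := fun m => |wt a b m|)
    (fun i _ => abs_nonneg _) (mem_support_iff.2 hm))

/-- The associated graded derivation. -/
theorem gr_exists (ha : 0 < a) (hb : 0 < b)
    {d : Derivation k (MvPolynomial (Fin 2) k) (MvPolynomial (Fin 2) k)}
    (hd : IsLND d) (hne : d ≠ 0) :
    ∃ (δ : Derivation k (MvPolynomial (Fin 2) k) (MvPolynomial (Fin 2) k)) (e : ℤ),
      IsLND δ ∧ δ ≠ 0 ∧ ∀ (n : ℤ) (f g : MvPolynomial (Fin 2) k), Hm a b n g →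
        Le a b (n - 1) (f - g) → Hm a b (n + e) (δ g) ∧ Le a b (n + e - 1) (d f - δ g) := by
  classical
  -- find the least e
  have hex : ∃ e : ℤ, (Le a b (a + e) (d (X 0)) ∧ Le a b (b + e) (d (X 1))) ∧
      ∀ e', (Le a b (a + e') (d (X 0)) ∧ Le a b (b + e') (d (X 1))) → e ≤ e' := by
    apply Int.exists_least_of_bdd
    · refine ⟨-(a + b), fun e he => ?_⟩
      by_contra hlt
      push Not at hlt
      apply hne
      apply derivation_ext
      intro i
      have neg : ∀ {n : ℤ} {f : MvPolynomial (Fin 2) k}, n < 0 → Le a b n f → f = 0 := by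
        intro n f hn hf
        refine Sp_false (fun m hm => ?_) hf
        have : 0 ≤ wt a b m := by unfold wt; positivity
        omega
      fin_cases i
      · simpa using neg (by omega) he.1
      · simpa using neg (by omega) he.2
    · obtain ⟨n0, h0⟩ := Le_exists a b (d (X 0))
      obtain ⟨n1, h1⟩ := Le_exists a b (d (X 1))
      refine ⟨max (n0 - a) (n1 - b), Le_mono ?_ h0, Le_mono ?_ h1⟩
      · have := le_max_left (n0 - a) (n1 - b); omega
      · have := le_max_right (n0 - a) (n1 - b); omega
  obtain ⟨e, ⟨h0, h1⟩, hmin⟩ := hex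
  obtain ⟨g0, hg0, hr0⟩ := Le_split h0
  obtain ⟨g1, hg1, hr1⟩ := Le_split h1
  let δ : Derivation k (MvPolynomial (Fin 2) k) (MvPolynomial (Fin 2) k) :=
    mkDerivation k ![g0, g1]
  have hδ0 : δ (X 0) = g0 := by simp [δ, mkDerivation_X]
  have hδ1 : δ (X 1) = g1 := by simp [δ, mkDerivation_X]
  have key : ∀ (n : ℤ) (f g : MvPolynomial (Fin 2) k), Hm a b n g →
        Le a b (n - 1) (f - g) → Hm a b (n + e) (δ g) ∧ Le a b (n + e - 1) (d f - δ g) := by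
    intro n f g hg hfg
    refine ⟨Hm_d (by rwa [hδ0]) (by rwa [hδ1]) hg, ?_⟩
    have e1 : d f - δ g = d (f - g) + (d - δ) g := by simp
    rw [e1]
    refine Sp_add ?_ ?_
    · have := Le_d h0 h1 hfg
      rwa [show n - 1 + e = n + e - 1 by ring] at this
    · have := Le_d (d := d - δ) (a := a) (b := b) (e := e - 1) (n := n) (f := g)
        (by simpa [hδ0, add_sub_assoc] using hr0) (by simpa [hδ1, add_sub_assoc] using hr1) (Hm_Le hg)
      rwa [← add_sub_assoc] at this
  refine ⟨δ, e, ?_, ?_, key⟩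
  · have hmon : ∀ m c, ∃ n, (⇑δ)^[n] (monomial m c) = 0 := by
      intro m c
      have hh : ∀ i : ℕ, Hm a b (wt a b m + i * e) ((⇑δ)^[i] (monomial m c)) ∧
          Le a b (wt a b m + i * e - 1) ((⇑d)^[i] (monomial m c) - (⇑δ)^[i] (monomial m c)) := by
        intro i
        induction i with
        | zero =>
          refine ⟨?_, by simpa using Le_zero (k := k) (wt a b m - 1)⟩
          simpa using Hm_monomial (a := a) (b := b) m c
        | succ i ih =>
          have := key _ _ _ ih.1 ih.2
          rw [Function.iterate_succ_apply', Function.iterate_succ_apply']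
          push_cast
          rwa [add_mul, one_mul, ← add_assoc]
      obtain ⟨i, hi⟩ := hd (monomial m c)
      refine ⟨i, ?_⟩
      have h2 := (hh i).2
      rw [hi, zero_sub] at h2
      exact Hm_Le_zero (sub_one_lt _) (hh i).1 (by simpa using Le_neg h2)
    intro f
    induction f using MvPolynomial.induction_on' with
    | monomial m c => exact hmon m c
    | add f g hf hg =>
      obtain ⟨i, hi⟩ := hf
      obtain ⟨j, hj⟩ := hg
      exact ⟨max i j, by rw [it_add, it_ge δ hi (le_max_left _ _), it_ge δ hj (le_max_right _ _),
        add_zero]⟩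
  · intro h
    rw [h] at hδ0 hδ1
    have := hmin (e - 1) ⟨?_, ?_⟩
    · omega
    · rw [← hδ0] at hr0
      simpa [add_sub_assoc] using hr0
    · rw [← hδ1] at hr1
      simpa [add_sub_assoc] using hr1

end Gr

open MvPolynomial

section Key
variable {k : Type*} [Field k]

theorem X_dvd_of_Sp (j : Fin 2) {f : MvPolynomial (Fin 2) k} (h : Sp (fun m => m j ≠ 0) f) :
    (X j : MvPolynomial (Fin 2) k) ∣ f := by
  rw [f.as_sum]
  refine Finset.dvd_sum fun m hm => ?_
  rw [X_dvd_monomial]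
  exact Or.inr (h m (mem_support_iff.1 hm))

theorem fin2_ext {m n : Fin 2 →₀ ℕ} (h0 : m 0 = n 0) (h1 : m 1 = n 1) : m = n := by
  ext i; fin_cases i
  · exact h0
  · exact h1

theorem prime_X2 (i : Fin 2) : Prime (X i : MvPolynomial (Fin 2) k) := by
  exact X_prime

variable [CharZero k]

theorem eq_of_X_dvd_sub {δ : Derivation k (MvPolynomial (Fin 2) k) (MvPolynomial (Fin 2) k)}
    (hδ : IsLND δ) (j : Fin 2) (hj : δ (X j) ≠ 0) {f g : MvPolynomial (Fin 2) k}
    (hf : δ f = 0) (hg : δ g = 0) (h : X j ∣ f - g) : f = g := by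
  by_contra hne
  exact hj (fact_closed_dvd δ hδ h (sub_ne_zero.2 hne) (by rw [map_sub, hf, hg, sub_zero]))

theorem mono_of_ker {δ : Derivation k (MvPolynomial (Fin 2) k) (MvPolynomial (Fin 2) k)}
    (hδ : IsLND δ) (j : Fin 2) (hj : δ (X j) ≠ 0) {f : MvPolynomial (Fin 2) k}
    (hf : δ f = 0) (hf0 : f ≠ 0)
    (huniq : ∀ m m', coeff m f ≠ 0 → coeff m' f ≠ 0 → m j = 0 → m' j = 0 → m = m')  :
    ∃ m, m j = 0 ∧ coeff m f ≠ 0 ∧ Sp (fun m' => m' j ≠ 0) (f - monomial m (coeff m f)) := by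
  classical
  have h1 : ∃ m, m j = 0 ∧ coeff m f ≠ 0 := by
    by_contra hcon
    push Not at hcon
    refine hj (fact_closed_dvd δ hδ (X_dvd_of_Sp j fun m hm hm' => hm (hcon m hm')) hf0 hf)
  obtain ⟨m, hm, hc⟩ := h1
  refine ⟨m, hm, hc, ?_⟩
  intro m' hm' h'
  rw [coeff_sub, coeff_monomial] at hm'
  split_ifs at hm' with hmm
  · subst hmm; simp at hm'
  · rw [sub_zero] at hm'
    exact hmm (huniq m m' hc hm' hm h')

theorem mono_of_ker' {δ : Derivation k (MvPolynomial (Fin 2) k) (MvPolynomial (Fin 2) k)}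
    (hδ : IsLND δ) (i j : Fin 2) (hij : i ≠ j) (hi : δ (X i) = 0)
    (hj : δ (X j) ≠ 0) {f : MvPolynomial (Fin 2) k}
    (hf : δ f = 0) (hf0 : f ≠ 0)
    (huniq : ∀ m m', coeff m f ≠ 0 → coeff m' f ≠ 0 → m j = 0 → m' j = 0 → m = m')  :
    ∃ m, m j = 0 ∧ coeff m f ≠ 0 ∧ f = monomial m (coeff m f) := by
  obtain ⟨m, hm, hc, h⟩ := mono_of_ker hδ j hj hf hf0 huniq
  refine ⟨m, hm, hc, eq_of_X_dvd_sub hδ j hj hf ?_ (X_dvd_of_Sp j h)⟩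
  apply derivation_eq_zero_of_forall_mem_vars
  intro l hl
  rw [vars_monomial hc] at hl
  have : l = i := by
    have : l ≠ j := by rintro rfl; simp [hm] at hl
    omega
  rw [this, hi]

theorem ab_one {δ : Derivation k (MvPolynomial (Fin 2) k) (MvPolynomial (Fin 2) k)}
    (hδ : IsLND δ) (h0 : δ (X 0) ≠ 0) (h1 : δ (X 1) ≠ 0) {a b : ℕ} (ha : 0 < a) (hb : 0 < b)
    {μ : k} (hf : δ (X 0 ^ b - C μ * X 1 ^ a) = 0) : μ ≠ 0 ∧ (a = 1 ∨ b = 1) := by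
  have hμ : μ ≠ 0 := by
    rintro rfl
    simp only [map_zero, zero_mul, sub_zero] at hf
    exact h0 (fact_closed_dvd δ hδ (dvd_pow_self _ hb.ne') (pow_ne_zero _ (X_ne_zero 0)) hf)
  refine ⟨hμ, ?_⟩
  by_contra hcon
  push Not at hcon
  obtain ⟨a, rfl⟩ : ∃ a', a = a' + 2 := ⟨a - 2, by omega⟩
  obtain ⟨b, rfl⟩ : ∃ a', b = a' + 2 := ⟨b - 2, by omega⟩
  have e1 : (((b + 2 : ℕ) : k)) ≠ 0 := Nat.cast_ne_zero.2 (by omega)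
  have e2 : (((a + 2 : ℕ) : k)) ≠ 0 := Nat.cast_ne_zero.2 (by omega)
  have h : C ((b + 2 : ℕ) : k) * (X 0 ^ (b + 1) * δ (X 0)) =
      C (μ * ((a + 2 : ℕ) : k)) * (X 1 ^ (a + 1) * δ (X 1)) := by
    rw [map_sub, Derivation.leibniz, Derivation.leibniz_pow, Derivation.leibniz_pow,
      derivation_C, sub_eq_zero] at hf
    simp only [smul_eq_mul, nsmul_eq_mul, mul_zero, add_zero] at hf
    simp only [C_mul, map_natCast]
    rw [show b + 2 - 1 = b + 1 by omega, show a + 2 - 1 = a + 1 by omega] at hf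
    rw [hf]; ring
  have nd : ∀ i j : Fin 2, i ≠ j → ¬ (X i : MvPolynomial (Fin 2) k) ∣ X j := by
    intro i j hij hd
    exact hij (X_dvd_X.1 hd)
  have ndC : ∀ (i : Fin 2) (c : k), c ≠ 0 → ¬ (X i : MvPolynomial (Fin 2) k) ∣ C c := by
    intro i c hc hd
    exact (prime_X2 i).not_isUnit (isUnit_of_dvd_unit hd ((isUnit_iff_ne_zero.2 hc).map C))
  have d1 : (X 1 : MvPolynomial (Fin 2) k) ∣ δ (X 0) := by
    have : (X 1 : MvPolynomial (Fin 2) k) ∣ C ((b + 2 : ℕ) : k) * (X 0 ^ (b + 1) * δ (X 0)) := by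
      rw [h, pow_succ]
      exact ⟨C (μ * ((a + 2 : ℕ) : k)) * (X 1 ^ a * δ (X 1)), by ring⟩
    rcases (prime_X2 1).dvd_or_dvd this with h' | h'
    · exact absurd h' (ndC _ _ e1)
    rcases (prime_X2 1).dvd_or_dvd h' with h' | h'
    · exact absurd ((prime_X2 1).dvd_of_dvd_pow h') (nd _ _ (by decide))
    · exact h'
  have d0 : (X 0 : MvPolynomial (Fin 2) k) ∣ δ (X 1) := by
    have : (X 0 : MvPolynomial (Fin 2) k) ∣
        C (μ * ((a + 2 : ℕ) : k)) * (X 1 ^ (a + 1) * δ (X 1)) := by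
      rw [← h, pow_succ]
      exact ⟨C ((b + 2 : ℕ) : k) * (X 0 ^ b * δ (X 0)), by ring⟩
    rcases (prime_X2 0).dvd_or_dvd this with h' | h'
    · exact absurd h' (ndC _ _ (mul_ne_zero hμ e2))
    rcases (prime_X2 0).dvd_or_dvd h' with h' | h'
    · exact absurd ((prime_X2 0).dvd_of_dvd_pow h') (nd _ _ (by decide))
    · exact h'
  obtain ⟨g0, hg0⟩ := d1
  obtain ⟨g1, hg1⟩ := d0
  obtain ⟨m, hm⟩ := ndeg_exists δ hδ (X_ne_zero (R := k) (0 : Fin 2))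
  obtain ⟨n, hn⟩ := ndeg_exists δ hδ (X_ne_zero (R := k) (1 : Fin 2))
  have k0 := ndeg_of_d δ hm h0
  have k1 := ndeg_of_d δ hn h1
  obtain ⟨r, hr⟩ := ndeg_exists δ hδ (right_ne_zero_of_mul (hg0 ▸ h0))
  obtain ⟨s, hs⟩ := ndeg_exists δ hδ (right_ne_zero_of_mul (hg1 ▸ h1))
  have u0 := ndeg_unique δ k0.2 (hg0 ▸ ndeg_mul δ hn hr)
  have u1 := ndeg_unique δ k1.2 (hg1 ▸ ndeg_mul δ hm hs)
  omega

theorem hom_ker [IsAlgClosed k]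
    {δ : Derivation k (MvPolynomial (Fin 2) k) (MvPolynomial (Fin 2) k)}
    (hδ : IsLND δ) (h0 : δ (X 0) ≠ 0) (h1 : δ (X 1) ≠ 0) {a b : ℕ} (ha : 0 < a) (hb : 0 < b)
    (hab : Nat.Coprime a b) {n : ℤ} (hn : 0 < n)
    {f : MvPolynomial (Fin 2) k} (hfh : Hm a b n f) (hf : δ f = 0) (hf0 : f ≠ 0) :
    ∃ (e : ℕ) (c μ : k), 0 < e ∧ c ≠ 0 ∧ μ ≠ 0 ∧ (a = 1 ∨ b = 1) ∧ n = a * b * e ∧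
      f = C c * (X 0 ^ b - C μ * X 1 ^ a) ^ e := by
  classical
  have ha' : (a : ℤ) ≠ 0 := by exact_mod_cast ha.ne'
  have hb' : (b : ℤ) ≠ 0 := by exact_mod_cast hb.ne'
  have hW : ∀ m, coeff m f ≠ 0 → (a : ℤ) * m 0 + b * m 1 = n := fun m hm => hfh m hm
  obtain ⟨m, hm1, hmc, hm⟩ := mono_of_ker hδ 1 h1 hf hf0 (fun m m' hm hm' h h' => by
    refine fin2_ext ?_ (by rw [h, h'])
    have e1 := hW m hm
    have e2 := hW m' hm'
    rw [h] at e1; rw [h'] at e2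
    have : (a : ℤ) * m 0 = a * m' 0 := by linarith
    exact_mod_cast mul_left_cancel₀ ha' this)
  obtain ⟨r, hr0, hrc, -⟩ := mono_of_ker hδ 0 h0 hf hf0 (fun m m' hm hm' h h' => by
    refine fin2_ext (by rw [h, h']) ?_
    have e1 := hW m hm
    have e2 := hW m' hm'
    rw [h] at e1; rw [h'] at e2
    have : (b : ℤ) * m 1 = b * m' 1 := by linarith
    exact_mod_cast mul_left_cancel₀ hb' this)
  have em := hW m hmc
  have er := hW r hrc
  rw [hm1] at em
  rw [hr0] at er
  have hmr : a * m 0 = b * r 1 := by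
    have : (a : ℤ) * m 0 = b * r 1 := by push_cast at em er; linarith
    exact_mod_cast this
  obtain ⟨e, he⟩ : b ∣ m 0 := (Nat.Coprime.dvd_of_dvd_mul_left hab.symm ⟨_, hmr⟩)
  have hne : n = a * b * e := by
    rw [he] at em; push_cast at em; linarith
  have hepos : 0 < e := by
    rcases Nat.eq_zero_or_pos e with h | h
    · subst h; simp at hne; omega
    · exact h
  -- for any monomial
  have hS : ∀ m', coeff m' f ≠ 0 → ∃ s, m' 0 = b * s ∧ a * s + m' 1 = a * e := by
    intro m' hm'
    have h2 := hW m' hm'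
    rw [hne] at h2
    have h3 : a * m' 0 + b * m' 1 = a * b * e := by exact_mod_cast h2
    obtain ⟨s, hs⟩ : b ∣ m' 0 := by
      apply Nat.Coprime.dvd_of_dvd_mul_left hab.symm
      rw [Nat.dvd_add_iff_left (Dvd.intro (m' 1) rfl), h3]
      exact ⟨a * e, by ring⟩
    refine ⟨s, hs, ?_⟩
    rw [hs] at h3
    apply Nat.eq_of_mul_eq_mul_left hb
    linarith
  let g : Polynomial k := ∑ m' ∈ f.support, Polynomial.monomial (m' 0 / b) (coeff m' f)
  have hge : g.coeff e = coeff m f := by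
    simp only [g, Polynomial.finsetSum_coeff, Polynomial.coeff_monomial]
    rw [Finset.sum_eq_single m]
    · simp [he, hb]
    · intro m' hm' hne'
      rw [if_neg]
      intro h
      obtain ⟨s, hs, hs'⟩ := hS m' (mem_support_iff.1 hm')
      rw [hs, Nat.mul_div_cancel_left _ hb] at h
      subst h
      exact hne' (fin2_ext (by rw [hs, he]) (by rw [hm1]; omega))
    · intro h
      exact absurd (mem_support_iff.2 hmc) h
  have hgdeg : g.degree ≠ 0 := by
    intro h
    rw [Polynomial.eq_C_of_degree_eq_zero h, Polynomial.coeff_C, if_neg hepos.ne'] at hge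
    exact hmc hge.symm
  obtain ⟨μ, hμ⟩ := IsAlgClosed.exists_root g hgdeg
  have hdvd : (X 0 ^ b - C μ * X 1 ^ a : MvPolynomial (Fin 2) k) ∣ f := by
    have h2 : (C (g.eval μ) * X 1 ^ (a * e) : MvPolynomial (Fin 2) k) =
        ∑ m' ∈ f.support, C (coeff m' f) * ((C μ * X 1 ^ a) ^ (m' 0 / b) * X 1 ^ (m' 1)) := by
      simp only [g, Polynomial.eval_finsetSum, Polynomial.eval_monomial, map_sum, Finset.sum_mul]
      refine Finset.sum_congr rfl fun m' hm' => ?_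
      obtain ⟨s, hs, hs'⟩ := hS m' (mem_support_iff.1 hm')
      rw [hs, Nat.mul_div_cancel_left _ hb, ← hs', C_mul, C_pow]
      ring
    have h3 : f = ∑ m' ∈ f.support, C (coeff m' f) * ((X 0 ^ b) ^ (m' 0 / b) * X 1 ^ (m' 1)) := by
      conv_lhs => rw [f.as_sum]
      refine Finset.sum_congr rfl fun m' hm' => ?_
      obtain ⟨s, hs, hs'⟩ := hS m' (mem_support_iff.1 hm')
      rw [monomial_eq, Finsupp.prod_fintype _ _ (by simp)]
      simp only [Fin.prod_univ_two]
      rw [← pow_mul, Nat.mul_div_cancel' ⟨s, hs⟩]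
    rw [hμ.eq_zero, C_0, zero_mul] at h2
    have h5 : (X 0 ^ b - C μ * X 1 ^ a : MvPolynomial (Fin 2) k) ∣
        (∑ m' ∈ f.support, C (coeff m' f) * ((X 0 ^ b) ^ (m' 0 / b) * X 1 ^ (m' 1))) -
        ∑ m' ∈ f.support, C (coeff m' f) * ((C μ * X 1 ^ a) ^ (m' 0 / b) * X 1 ^ (m' 1)) := by
      rw [← Finset.sum_sub_distrib]
      refine Finset.dvd_sum fun m' _ => ?_
      rw [← mul_sub, ← sub_mul]
      exact Dvd.dvd.mul_left (Dvd.dvd.mul_right (sub_dvd_pow_sub_pow _ _ _) _) _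
    rw [← h2, sub_zero] at h5
    rw [h3]; exact h5
  have hker := fact_closed_dvd δ hδ hdvd hf0 hf
  obtain ⟨hμ0, hab1⟩ := ab_one hδ h0 h1 ha hb hker
  refine ⟨e, coeff m f, μ, hepos, hmc, hμ0, hab1, hne, ?_⟩
  refine eq_of_X_dvd_sub hδ 1 h1 hf ?_ ?_
  · rw [Derivation.leibniz, Derivation.leibniz_pow, hker]; simp
  · have d1 := X_dvd_of_Sp 1 hm
    have hmm : (monomial m (coeff m f) : MvPolynomial (Fin 2) k) = C (coeff m f) * (X 0 ^ b) ^ e := by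
      rw [monomial_eq, Finsupp.prod_fintype _ _ (by simp)]
      simp only [Fin.prod_univ_two]
      rw [hm1, he, pow_mul]; simp
    have d2 : (X 1 : MvPolynomial (Fin 2) k) ∣ (X 0 ^ b) ^ e - (X 0 ^ b - C μ * X 1 ^ a) ^ e := by
      refine dvd_trans ?_ (sub_dvd_pow_sub_pow _ _ _)
      rw [sub_sub_cancel]
      exact Dvd.dvd.mul_left (dvd_pow_self _ ha.ne') _
    rw [hmm] at d1
    have := dvd_add d1 (Dvd.dvd.mul_left d2 (C (coeff m f)))
    convert this using 1
    ring

theorem pderiv_zero_degree {u : MvPolynomial (Fin 2) k} (i : Fin 2) (h : pderiv i u = 0) :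
    degreeOf i u = 0 := by
  have : degreeOf i u ≤ 0 := by
    rw [degreeOf_le_iff]
    intro m hm
    by_contra hpos
    have h2 : coeff (m - Finsupp.single i 1) (pderiv i u) = 0 := by rw [h]; simp
    rw [coeff_pderiv] at h2
    have h3 : m - Finsupp.single i 1 + Finsupp.single i 1 = m := by
      apply tsub_add_cancel_of_le
      rw [Finsupp.single_le_iff]; omega
    rw [h3] at h2
    rcases mul_eq_zero.1 h2 with h4 | h4
    · exact mem_support_iff.1 hm h4
    · exact absurd h4 (Nat.cast_add_one_ne_zero _)
  omega

theorem pderiv_eq_zero_of_degreeOf {u : MvPolynomial (Fin 2) k} (i : Fin 2)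
    (h : degreeOf i u = 0) : pderiv i u = 0 := by
  ext m
  rw [coeff_pderiv, coeff_zero]
  by_cases hm : coeff (m + Finsupp.single i 1) u = 0
  · rw [hm, zero_mul]
  · have := degreeOf_le_iff.1 h.le _ (mem_support_iff.2 hm)
    simp at this

theorem const_of_degrees {u : MvPolynomial (Fin 2) k} (h0 : degreeOf 0 u = 0)
    (h1 : degreeOf 1 u = 0) : u = C (coeff 0 u) := by
  classical
  ext m
  rw [coeff_C]
  split_ifs with h
  · rw [h]
  · by_contra hm
    have a0 := degreeOf_le_iff.1 h0.le m (mem_support_iff.2 hm)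
    have a1 := degreeOf_le_iff.1 h1.le m (mem_support_iff.2 hm)
    exact h (fin2_ext (Nat.le_zero.1 a0).symm (Nat.le_zero.1 a1).symm)

theorem exists_degreeOf {u : MvPolynomial (Fin 2) k} (hu : u ≠ 0) (i : Fin 2) :
    ∃ m, coeff m u ≠ 0 ∧ m i = degreeOf i u := by
  rw [degreeOf_eq_sup]
  obtain ⟨m, hm, h⟩ := Finset.exists_mem_eq_sup u.support (support_nonempty.2 hu) (fun m => m i)
  exact ⟨m, mem_support_iff.1 hm, h.symm⟩

theorem key_form [IsAlgClosed k]
    {d : Derivation k (MvPolynomial (Fin 2) k) (MvPolynomial (Fin 2) k)}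
    (hd : IsLND d) (h0 : d (X 0) ≠ 0) (h1 : d (X 1) ≠ 0)
    {u : MvPolynomial (Fin 2) k} (hu : d u = 0) (hnc : ∀ c, u ≠ C c) :
    ∃ (a b e : ℕ) (c μ : k), 0 < a ∧ 0 < b ∧ 0 < e ∧ c ≠ 0 ∧ μ ≠ 0 ∧ (a = 1 ∨ b = 1) ∧
      Le a b (a * b * e) u ∧ Le a b (a * b * e - 1) (u - C c * (X 0 ^ b - C μ * X 1 ^ a) ^ e) := by
  classical
  have hu0 : u ≠ 0 := by simpa using hnc 0
  have hdu := der_eq d u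
  rw [hu] at hdu
  have q0 : degreeOf 0 u ≠ 0 := by
    intro h
    have : pderiv 0 u = 0 := pderiv_eq_zero_of_degreeOf _ h
    rw [this] at hdu
    have h' : pderiv 1 u = 0 := by simpa [h1] using hdu.symm
    exact hnc _ (const_of_degrees h (pderiv_zero_degree 1 h'))
  have q1 : degreeOf 1 u ≠ 0 := by
    intro h
    have : pderiv 1 u = 0 := pderiv_eq_zero_of_degreeOf _ h
    rw [this] at hdu
    have h' : pderiv 0 u = 0 := by simpa [h0] using hdu.symm
    exact hnc _ (const_of_degrees (pderiv_zero_degree 0 h') h)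
  set my := degreeOf 0 u with hmy
  set mz := degreeOf 1 u with hmz
  obtain ⟨g, b, a, hgpos, hcop, hb, ha⟩ := Nat.exists_coprime' (m := my) (n := mz)
    (Nat.gcd_pos_of_pos_left _ (by omega))
  have hapos : 0 < a := by rcases Nat.eq_zero_or_pos a with h | h; · simp [h] at ha; omega
                           · exact h
  have hbpos : 0 < b := by rcases Nat.eq_zero_or_pos b with h | h; · simp [h] at hb; omega
                           · exact h
  have hapos' : (0 : ℤ) < a := by exact_mod_cast hapos
  have hbpos' : (0 : ℤ) < b := by exact_mod_cast hbpos
  have hswap : (a : ℤ) * my = b * mz := by rw [ha, hb]; push_cast; ring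
  -- top degree
  have hex : ∃ n : ℤ, Le a b n u ∧ ∀ n', Le a b n' u → n ≤ n' := by
    apply Int.exists_least_of_bdd
    · refine ⟨0, fun n hn => ?_⟩
      obtain ⟨m, hm, -⟩ := exists_degreeOf hu0 0
      exact le_trans (by unfold wt; positivity) (hn m hm)
    · exact Le_exists _ _ _
  obtain ⟨n, hn, hmin⟩ := hex
  obtain ⟨û, hû, hr⟩ := Le_split hn
  have hû0 : û ≠ 0 := by
    rintro rfl
    have := hmin (n - 1) (by simpa using hr)
    omega
  have hco : ∀ m, wt a b m = n → coeff m û = coeff m u := by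
    intro m hm
    by_contra hne
    have := hr m (by rw [coeff_sub]; exact sub_ne_zero.2 (Ne.symm hne))
    omega
  have hW : ∀ m, coeff m û ≠ 0 → (a : ℤ) * m 0 + b * m 1 = n := fun m hm => hû m hm
  obtain ⟨m0, hm0, hm0'⟩ := exists_degreeOf hu0 0
  obtain ⟨m1, hm1, hm1'⟩ := exists_degreeOf hu0 1
  have l0 : (a : ℤ) * m0 0 + b * m0 1 ≤ n := hn m0 hm0
  have l1 : (a : ℤ) * m1 0 + b * m1 1 ≤ n := hn m1 hm1
  rw [hm0', ← hmy] at l0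
  rw [hm1', ← hmz] at l1
  have hnpos : 0 < n := by
    have : (0 : ℤ) < a * my := by have : 0 < my := by omega
                                  positivity
    have : (0 : ℤ) ≤ b * m0 1 := by positivity
    omega
  obtain ⟨δ, E, hδ, hδ0, hgr⟩ := gr_exists hapos' hbpos' hd (by rintro rfl; simp at h0)
  have hδu : δ û = 0 := by
    have := hgr n u û hû hr
    rw [hu, zero_sub] at this
    exact Hm_Le_zero (sub_one_lt _) this.1 (by simpa using Le_neg this.2)
  have hnot : ¬ (δ (X 0) = 0 ∧ δ (X 1) = 0) := by
    rintro ⟨e0, e1⟩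
    apply hδ0
    apply derivation_ext
    intro i
    fin_cases i
    · simpa using e0
    · simpa using e1
  have z0 : δ (X 0) ≠ 0 := by
    intro hz
    obtain ⟨m, hmz', hmc, heq⟩ := mono_of_ker' hδ 0 1 (by decide) hz (fun h => hnot ⟨hz, h⟩) hδu hû0
      (fun m m' hm hm' h h' => by
        refine fin2_ext ?_ (by rw [h, h'])
        have e1 := hW m hm
        have e2 := hW m' hm'
        rw [h] at e1; rw [h'] at e2
        have : (a : ℤ) * m 0 = a * m' 0 := by linarith
        exact_mod_cast mul_left_cancel₀ hapos'.ne' this)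
    have e1 := hW m hmc
    rw [hmz'] at e1
    have hle : m 0 ≤ my := degreeOf_le_iff.1 hmy.ge m (by
      rw [mem_support_iff, ← hco m (hû m hmc)]; exact hmc)
    have hle' : (a : ℤ) * m 0 ≤ a * my := by gcongr
    have hge : (0 : ℤ) ≤ a * m1 0 := by positivity
    have : wt a b m1 = n := by
      unfold wt; rw [hm1', ← hmz]; push_cast at e1; linarith
    have hc1 : coeff m1 û ≠ 0 := by rw [hco m1 this]; exact hm1
    rw [heq, coeff_monomial] at hc1
    split_ifs at hc1 with h
    · rw [h] at hmz'; omega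
    · exact hc1 rfl
  have z1 : δ (X 1) ≠ 0 := by
    intro hz
    obtain ⟨m, hmz', hmc, heq⟩ := mono_of_ker' hδ 1 0 (by decide) hz z0 hδu hû0
      (fun m m' hm hm' h h' => by
        refine fin2_ext (by rw [h, h']) ?_
        have e1 := hW m hm
        have e2 := hW m' hm'
        rw [h] at e1; rw [h'] at e2
        have : (b : ℤ) * m 1 = b * m' 1 := by linarith
        exact_mod_cast mul_left_cancel₀ hbpos'.ne' this)
    have e1 := hW m hmc
    rw [hmz'] at e1
    have hle : m 1 ≤ mz := degreeOf_le_iff.1 hmz.ge m (by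
      rw [mem_support_iff, ← hco m (hû m hmc)]; exact hmc)
    have hle' : (b : ℤ) * m 1 ≤ b * mz := by gcongr
    have hge : (0 : ℤ) ≤ b * m0 1 := by positivity
    have : wt a b m0 = n := by
      unfold wt; rw [hm0', ← hmy]; push_cast at e1; linarith
    have hc1 : coeff m0 û ≠ 0 := by rw [hco m0 this]; exact hm0
    rw [heq, coeff_monomial] at hc1
    split_ifs at hc1 with h
    · rw [h] at hmz'; omega
    · exact hc1 rfl
  obtain ⟨e, c, μ, he, hc, hμ, hab1, hne, heq⟩ := hom_ker hδ z0 z1 hapos hbpos hcop.symm hnpos hû hδu hû0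
  refine ⟨a, b, e, c, μ, hapos, hbpos, he, hc, hμ, hab1, ?_, ?_⟩
  · rw [← hne]; exact hn
  · rw [← hne, ← heq]; exact hr

end Key

open MvPolynomial

section Aut
variable {k : Type*} [Field k]

theorem chain {ι A : Type*} [Fintype ι] [CommRing A] [Algebra k A] (d : Derivation k A A)
    (φ : MvPolynomial ι k →ₐ[k] A) (f : MvPolynomial ι k) :
    d (φ f) = ∑ i, φ (pderiv i f) * d (φ (X i)) := by
  classical
  induction f using MvPolynomial.induction_on with
  | C a =>
    have : φ (C a) = algebraMap k A a := φ.commutes a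
    rw [this]; simp
  | add f g hf hg => simp only [map_add, hf, hg, add_mul, Finset.sum_add_distrib]
  | mul_X f j hf =>
    simp only [map_mul, Derivation.leibniz, hf, smul_eq_mul, map_add, add_mul,
      Finset.sum_add_distrib, pderiv_X]
    congr 1
    · rw [Finset.sum_eq_single j]
      · simp
      · intro i _ hi; simp [Pi.single_eq_of_ne' hi]
      · simp
    · rw [Finset.mul_sum]
      refine Finset.sum_congr rfl fun i _ => by ring

/-- conjugate of a derivation -/
noncomputable def conj {A : Type*} [CommRing A] [Algebra k A] (σ : A ≃ₐ[k] A)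
    (d : Derivation k A A) : Derivation k A A :=
  Derivation.mk' (σ.toLinearMap ∘ₗ d.toLinearMap ∘ₗ σ.symm.toLinearMap) (by
    intro a b
    simp [Derivation.leibniz])

section
variable {A : Type*} [CommRing A] [Algebra k A] (σ : A ≃ₐ[k] A) (d : Derivation k A A)

theorem conj_apply (f : A) : conj σ d f = σ (d (σ.symm f)) := rfl

theorem conj_apply' (f : A) : conj σ d (σ f) = σ (d f) := by rw [conj_apply, σ.symm_apply_apply]

theorem conj_it (n : ℕ) (f : A) : (⇑(conj σ d))^[n] (σ f) = σ ((⇑d)^[n] f) := by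
  induction n with
  | zero => rfl
  | succ n ih => rw [Function.iterate_succ_apply', ih, conj_apply', Function.iterate_succ_apply']

theorem conj_lnd (hd : IsLND d) : IsLND (conj σ d) := by
  intro f
  obtain ⟨n, hn⟩ := hd (σ.symm f)
  refine ⟨n, ?_⟩
  have := conj_it σ d n (σ.symm f)
  rwa [σ.apply_symm_apply, hn, map_zero] at this

theorem irred_iff : IsIrred d ↔ ∀ b, (∀ g, b ∣ d g) → IsUnit b := by
  unfold IsIrred
  refine forall_congr' fun b => ?_
  rw [Ideal.span_le]
  have : (Set.range ⇑d ⊆ ↑(Ideal.span {b})) ↔ ∀ g, b ∣ d g := by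
    constructor
    · intro h g
      exact Ideal.mem_span_singleton.1 (h ⟨g, rfl⟩)
    · rintro h _ ⟨g, rfl⟩
      exact Ideal.mem_span_singleton.2 (h g)
  rw [this]

theorem conj_irred (hd : IsIrred d) : IsIrred (conj σ d) := by
  rw [irred_iff] at hd ⊢
  intro b hb
  have := hd (σ.symm b) (fun g => by
    have h := hb (σ g)
    rw [conj_apply'] at h
    have h2 := map_dvd σ.symm h
    rwa [σ.symm_apply_apply] at h2)
  have h2 := this.map σ
  rwa [σ.apply_symm_apply] at h2

end

/-- elementary automorphism `z ↦ z + h(y)` -/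
noncomputable def Eh (h : Polynomial k) : MvPolynomial (Fin 2) k →ₐ[k] MvPolynomial (Fin 2) k :=
  aeval ![X 0, X 1 + Polynomial.aeval (X 0) h]

theorem Eh_X0 (h : Polynomial k) : Eh h (X 0) = X 0 := by simp [Eh]
theorem Eh_X1 (h : Polynomial k) : Eh h (X 1) = X 1 + Polynomial.aeval (X 0) h := by simp [Eh]

theorem Eh_pol (h g : Polynomial k) :
    Eh h (Polynomial.aeval (X 0) g) = Polynomial.aeval (X 0) g := by
  rw [← Polynomial.aeval_algHom_apply, Eh_X0]

theorem Eh_comp (h g : Polynomial k) : (Eh h).comp (Eh g) = Eh (h + g) := by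
  apply MvPolynomial.algHom_ext
  intro i
  fin_cases i
  · simp [Eh_X0]
  · simp [Eh_X1, Eh_pol, add_assoc]

theorem Eh_zero : Eh (0 : Polynomial k) = AlgHom.id k _ := by
  apply MvPolynomial.algHom_ext
  intro i
  fin_cases i
  · simp [Eh_X0]
  · simp [Eh_X1]

noncomputable def E (h : Polynomial k) : MvPolynomial (Fin 2) k ≃ₐ[k] MvPolynomial (Fin 2) k :=
  AlgEquiv.ofAlgHom (Eh h) (Eh (-h)) (by rw [Eh_comp, add_neg_cancel, Eh_zero])
    (by rw [Eh_comp, neg_add_cancel, Eh_zero])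

theorem E_apply (h : Polynomial k) (f) : E h f = Eh h f := rfl
theorem E_symm (h : Polynomial k) (f) : (E h).symm f = Eh (-h) f := rfl
theorem E_X0 (h : Polynomial k) : E h (X 0) = X 0 := Eh_X0 h
theorem E_X1 (h : Polynomial k) : E h (X 1) = X 1 + Polynomial.aeval (X 0) h := Eh_X1 h
theorem E_add (h g : Polynomial k) (f) : E h (E g f) = E (h + g) f := by
  simp only [E_apply]; rw [← Eh_comp]; rfl

noncomputable def Sh : MvPolynomial (Fin 2) k →ₐ[k] MvPolynomial (Fin 2) k :=
  aeval ![X 1, X 0]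

/-- the swap -/
noncomputable def Sw : MvPolynomial (Fin 2) k ≃ₐ[k] MvPolynomial (Fin 2) k :=
  AlgEquiv.ofAlgHom Sh Sh (by
      apply MvPolynomial.algHom_ext; intro i; fin_cases i <;> simp [Sh]) (by
      apply MvPolynomial.algHom_ext; intro i; fin_cases i <;> simp [Sh])

theorem Sw_X0 : (Sw : MvPolynomial (Fin 2) k ≃ₐ[k] MvPolynomial (Fin 2) k) (X 0) = X 1 := by
  show Sh (X 0) = X 1
  simp [Sh]
theorem Sw_X1 : (Sw : MvPolynomial (Fin 2) k ≃ₐ[k] MvPolynomial (Fin 2) k) (X 1) = X 0 := by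
  show Sh (X 1) = X 0
  simp [Sh]
theorem Sw_symm (f : MvPolynomial (Fin 2) k) : Sw.symm f = Sw f := rfl
theorem Sw_Sw (f : MvPolynomial (Fin 2) k) : Sw (Sw f) = f := by
  conv_rhs => rw [← Sw.symm_apply_apply f]
  rfl

/-- Jacobian bracket -/
noncomputable def jac2 (u g : MvPolynomial (Fin 2) k) : MvPolynomial (Fin 2) k :=
  pderiv 0 u * pderiv 1 g - pderiv 1 u * pderiv 0 g

theorem jac2_hom (φ : MvPolynomial (Fin 2) k →ₐ[k] MvPolynomial (Fin 2) k)
    (u g : MvPolynomial (Fin 2) k) :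
    jac2 (φ u) (φ g) = φ (jac2 u g) * jac2 (φ (X 0)) (φ (X 1)) := by
  simp only [jac2, chain (pderiv 0) φ u, chain (pderiv 1) φ u, chain (pderiv 0) φ g,
    chain (pderiv 1) φ g, Fin.sum_univ_two, map_sub, map_mul]
  ring

/-- Jacobian form of a derivation -/
def JF (d : Derivation k (MvPolynomial (Fin 2) k) (MvPolynomial (Fin 2) k))
    (u : MvPolynomial (Fin 2) k) (γ : k) : Prop := ∀ g, d g = C γ * jac2 u g

theorem JF_conj {d : Derivation k (MvPolynomial (Fin 2) k) (MvPolynomial (Fin 2) k)}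
    {u : MvPolynomial (Fin 2) k} {γ : k} (σ : MvPolynomial (Fin 2) k ≃ₐ[k] MvPolynomial (Fin 2) k)
    {c : k} (hc : c ≠ 0) (hσ : jac2 (σ (X 0)) (σ (X 1)) = C c) (h : JF d u γ) :
    JF (conj σ d) (σ u) (γ * c⁻¹) := by
  intro g
  have e1 : jac2 (σ u) (σ (σ.symm g)) = σ (jac2 u (σ.symm g)) * jac2 (σ (X 0)) (σ (X 1)) :=
    jac2_hom (σ : MvPolynomial (Fin 2) k →ₐ[k] MvPolynomial (Fin 2) k) u (σ.symm g)
  rw [hσ, σ.apply_symm_apply] at e1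
  rw [conj_apply, h, e1, map_mul]
  have : σ (C γ) = C γ := σ.commutes γ
  rw [this, C_mul, show C γ * C c⁻¹ * (σ (jac2 u (σ.symm g)) * C c) =
    C γ * σ (jac2 u (σ.symm g)) * C (c⁻¹ * c) by rw [C_mul]; ring, inv_mul_cancel₀ hc]
  simp

theorem jac2_E (h : Polynomial k) : jac2 (E h (X 0)) (E h (X 1)) = C (1 : k) := by
  rw [E_X0, E_X1]
  have : pderiv 1 (Polynomial.aeval (X 0 : MvPolynomial (Fin 2) k) h) = 0 := by
    rw [Derivation.map_aeval, pderiv_X]; simp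
  simp [jac2, this, pderiv_X]

theorem jac2_Sw : jac2 (Sw (X 0)) (Sw (X 1)) = C (-1 : k) := by
  rw [Sw_X0, Sw_X1]
  simp [jac2, pderiv_X]

theorem JF_E {d : Derivation k (MvPolynomial (Fin 2) k) (MvPolynomial (Fin 2) k)}
    {u : MvPolynomial (Fin 2) k} {γ : k} (h : Polynomial k) (hJ : JF d u γ) :
    JF (conj (E h) d) (E h u) γ := by
  simpa using JF_conj (E h) one_ne_zero (jac2_E h) hJ

theorem JF_Sw {d : Derivation k (MvPolynomial (Fin 2) k) (MvPolynomial (Fin 2) k)}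
    {u : MvPolynomial (Fin 2) k} {γ : k} (hJ : JF d u γ) :
    JF (conj Sw d) (Sw u) (-γ) := by
  have := JF_conj Sw (c := (-1 : k)) (by simp) jac2_Sw hJ
  rwa [inv_neg, inv_one, mul_neg, mul_one] at this

theorem Le_hom {a b a' b' n : ℤ} (φ : MvPolynomial (Fin 2) k →ₐ[k] MvPolynomial (Fin 2) k)
    (h0 : Le a' b' a (φ (X 0))) (h1 : Le a' b' b (φ (X 1))) {f : MvPolynomial (Fin 2) k}
    (hf : Le a b n f) : Le a' b' n (φ f) := by
  rw [f.as_sum, map_sum]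
  refine Sp_sum _ _ fun m hm => ?_
  have hle := hf m (mem_support_iff.1 hm)
  refine Le_mono hle ?_
  rw [monomial_eq, Finsupp.prod_fintype _ _ (by simp)]
  simp only [Fin.prod_univ_two, map_mul, map_pow]
  have hC : φ (C (coeff m f)) = C (coeff m f) := φ.commutes _
  rw [hC]
  have := Le_mul (Hm_Le (Hm_C (a := a') (b := b') (coeff m f))) (Le_mul (Le_pow h0 (m 0)) (Le_pow h1 (m 1)))
  refine Le_mono ?_ this
  unfold wt; linarith

theorem Le_degreeOf0 {f : MvPolynomial (Fin 2) k} {n : ℕ} : Le 1 0 n f ↔ degreeOf 0 f ≤ n := by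
  rw [degreeOf_le_iff]
  constructor
  · intro h m hm
    have := h m (mem_support_iff.1 hm)
    simp [wt] at this; exact this
  · intro h m hm
    have := h m (mem_support_iff.2 hm)
    simp [wt]; exact this

theorem Le_degreeOf1 {f : MvPolynomial (Fin 2) k} {n : ℕ} : Le 0 1 n f ↔ degreeOf 1 f ≤ n := by
  rw [degreeOf_le_iff]
  constructor
  · intro h m hm
    have := h m (mem_support_iff.1 hm)
    simp [wt] at this; exact this
  · intro h m hm
    have := h m (mem_support_iff.2 hm)
    simp [wt]; exact this

theorem Le_pol {a b : ℤ} {n : ℕ} (ha : 0 ≤ a) {f : MvPolynomial (Fin 2) k} (hf : Le a b a f)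
    {g : Polynomial k} (hg : g.natDegree ≤ n) : Le a b (n * a) (Polynomial.aeval f g) := by
  rw [Polynomial.aeval_eq_sum_range' (Nat.lt_succ_of_le hg)]
  refine Sp_sum _ _ fun i hi => ?_
  rw [smul_eq_C_mul]
  have := Le_mul (Hm_Le (Hm_C (a := a) (b := b) (g.coeff i))) (Le_pow hf i)
  refine Le_mono ?_ this
  have : (i : ℤ) ≤ n := by exact_mod_cast Nat.le_of_lt_succ (Finset.mem_range.1 hi)
  nlinarith

theorem Sw_degrees (f : MvPolynomial (Fin 2) k) :
    degreeOf 0 (Sw f) = degreeOf 1 f ∧ degreeOf 1 (Sw f) = degreeOf 0 f := by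
  have h0 : ∀ f : MvPolynomial (Fin 2) k, degreeOf 0 (Sw f) ≤ degreeOf 1 f := by
    intro f
    rw [← Le_degreeOf0]
    exact Le_hom (a := 0) (b := 1) (Sw : MvPolynomial (Fin 2) k ≃ₐ[k] _).toAlgHom
      (by show Le 1 0 0 (Sw (X 0)); rw [Sw_X0]; exact Hm_Le Hm_X1)
      (by show Le 1 0 1 (Sw (X 1)); rw [Sw_X1]; exact Hm_Le Hm_X0) (Le_degreeOf1.2 le_rfl)
  have h1 : ∀ f : MvPolynomial (Fin 2) k, degreeOf 1 (Sw f) ≤ degreeOf 0 f := by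
    intro f
    rw [← Le_degreeOf1]
    exact Le_hom (a := 1) (b := 0) (Sw : MvPolynomial (Fin 2) k ≃ₐ[k] _).toAlgHom
      (by show Le 0 1 1 (Sw (X 0)); rw [Sw_X0]; exact Hm_Le Hm_X1)
      (by show Le 0 1 0 (Sw (X 1)); rw [Sw_X1]; exact Hm_Le Hm_X0) (Le_degreeOf0.2 le_rfl)
  refine ⟨le_antisymm (h0 f) ?_, le_antisymm (h1 f) ?_⟩
  · have := h1 (Sw f); rwa [Sw_Sw] at this
  · have := h0 (Sw f); rwa [Sw_Sw] at this

theorem E_degree1 (h : Polynomial k) (f : MvPolynomial (Fin 2) k) :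
    degreeOf 1 (E h f) = degreeOf 1 f := by
  have h0 : ∀ (h : Polynomial k) (f : MvPolynomial (Fin 2) k),
      degreeOf 1 (E h f) ≤ degreeOf 1 f := by
    intro h f
    rw [← Le_degreeOf1]
    refine Le_hom (a := 0) (b := 1) (E h).toAlgHom
      (by show Le 0 1 0 (E h (X 0)); rw [E_X0]; exact Hm_Le Hm_X0)
      (by
        show Le 0 1 1 (E h (X 1)); rw [E_X1]
        refine Sp_add (Hm_Le Hm_X1) (Le_mono ?_ (Le_pol (n := h.natDegree) le_rfl (Hm_Le Hm_X0) le_rfl))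
        simp) (Le_degreeOf1.2 le_rfl)
  refine le_antisymm (h0 h f) ?_
  have := h0 (-h) (E h f)
  rwa [E_add, neg_add_cancel, show E (0 : Polynomial k) f = f by rw [E_apply, Eh_zero]; rfl] at this

/-- restriction to `z = 0` -/
theorem coeff_res0 (f : MvPolynomial (Fin 2) k) (n : ℕ) :
    (aeval ![Polynomial.X, (0 : Polynomial k)] f).coeff n = coeff (Finsupp.single 0 n) f := by
  classical
  induction f using MvPolynomial.induction_on' with
  | monomial m c =>
    rw [aeval_monomial, Finsupp.prod_fintype _ _ (by simp)]
    simp only [Fin.prod_univ_two, coeff_monomial]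
    rcases Nat.eq_zero_or_pos (m 1) with h | h
    · simp only [Matrix.cons_val_zero, Matrix.cons_val_one, h, pow_zero, mul_one]
      rw [show (algebraMap k (Polynomial k) c) = Polynomial.C c from rfl,
        Polynomial.coeff_C_mul_X_pow]
      by_cases hn : n = m 0
      · rw [if_pos hn, if_pos (fin2_ext (by simp [hn]) (by simp [h]))]
      · rw [if_neg hn, if_neg]
        rintro rfl
        simp at hn
    · simp only [Matrix.cons_val_zero, Matrix.cons_val_one, zero_pow h.ne', mul_zero]
      rw [if_neg]
      · simp
      · rintro rfl
        simp at h
  | add f g hf hg => rw [map_add, Polynomial.coeff_add, hf, hg, coeff_add]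

theorem coeff_res1 (f : MvPolynomial (Fin 2) k) (n : ℕ) :
    (aeval ![(0 : Polynomial k), Polynomial.X] f).coeff n = coeff (Finsupp.single 1 n) f := by
  classical
  induction f using MvPolynomial.induction_on' with
  | monomial m c =>
    rw [aeval_monomial, Finsupp.prod_fintype _ _ (by simp)]
    simp only [Fin.prod_univ_two, coeff_monomial]
    rcases Nat.eq_zero_or_pos (m 0) with h | h
    · simp only [Matrix.cons_val_zero, Matrix.cons_val_one, h, pow_zero, one_mul]
      rw [show (algebraMap k (Polynomial k) c) = Polynomial.C c from rfl,
        Polynomial.coeff_C_mul_X_pow]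
      by_cases hn : n = m 1
      · rw [if_pos hn, if_pos (fin2_ext (by simp [h]) (by simp [hn]))]
      · rw [if_neg hn, if_neg]
        rintro rfl
        simp at hn
    · simp only [Matrix.cons_val_zero, Matrix.cons_val_one, zero_pow h.ne', mul_zero, zero_mul]
      rw [if_neg]
      · simp
      · rintro rfl
        simp at h
  | add f g hf hg => rw [map_add, Polynomial.coeff_add, hf, hg, coeff_add]

/-- data produced by `key_form` -/
structure KF (a b e : ℕ) (c μ : k) (u : MvPolynomial (Fin 2) k) : Prop where
  ha : 0 < a
  hb : 0 < b
  he : 0 < e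
  hc : c ≠ 0
  hμ : μ ≠ 0
  hab : a = 1 ∨ b = 1
  le : Le a b (a * b * e) u
  rem : Le a b (a * b * e - 1) (u - C c * (X 0 ^ b - C μ * X 1 ^ a) ^ e)

theorem KF.coeff0 {a b e : ℕ} {c μ : k} {u : MvPolynomial (Fin 2) k} (h : KF a b e c μ u) :
    coeff (Finsupp.single 0 (b * e)) u = c := by
  have h1 : coeff (Finsupp.single 0 (b * e)) (u - C c * (X 0 ^ b - C μ * X 1 ^ a) ^ e) = 0 := by
    by_contra hne
    have := h.rem _ hne
    simp [wt] at this
    nlinarith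
  rw [coeff_sub, sub_eq_zero] at h1
  rw [h1, ← coeff_res0]
  simp [h.ha.ne', ← pow_mul]

theorem KF.coeff1 {a b e : ℕ} {c μ : k} {u : MvPolynomial (Fin 2) k} (h : KF a b e c μ u) :
    coeff (Finsupp.single 1 (a * e)) u = c * (-μ) ^ e := by
  have h1 : coeff (Finsupp.single 1 (a * e)) (u - C c * (X 0 ^ b - C μ * X 1 ^ a) ^ e) = 0 := by
    by_contra hne
    have := h.rem _ hne
    simp [wt] at this
    nlinarith
  rw [coeff_sub, sub_eq_zero] at h1
  rw [h1, ← coeff_res1]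
  simp only [map_mul, map_pow, map_sub, aeval_X, Matrix.cons_val_zero, Matrix.cons_val_one,
    aeval_C, zero_pow h.hb.ne', zero_sub]
  rw [show ∀ c, (algebraMap k (Polynomial k) c) = Polynomial.C c from fun _ => rfl,
    show (algebraMap k (Polynomial k) μ) = Polynomial.C μ from rfl,
    show -(Polynomial.C μ * Polynomial.X ^ a) = Polynomial.C (-μ) * Polynomial.X ^ a by simp,
    mul_pow, ← pow_mul, ← mul_assoc, ← Polynomial.C_pow, ← Polynomial.C_mul,
    Polynomial.coeff_C_mul_X_pow]
  simp

theorem le_degreeOf_single {u : MvPolynomial (Fin 2) k} {i : Fin 2} {n : ℕ}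
    (h : coeff (Finsupp.single i n) u ≠ 0) : n ≤ degreeOf i u := by
  have := degreeOf_le_iff.1 (le_refl (degreeOf i u)) _ (mem_support_iff.2 h)
  simpa using this

theorem KF.deg0 {a b e : ℕ} {c μ : k} {u : MvPolynomial (Fin 2) k} (h : KF a b e c μ u) :
    degreeOf 0 u = b * e := by
  apply le_antisymm
  · rw [degreeOf_le_iff]
    intro m hm
    have h1 := h.le m (mem_support_iff.1 hm)
    simp only [wt] at h1
    have h2 : a * m 0 + b * m 1 ≤ a * b * e := by exact_mod_cast h1
    have h3 : a * m 0 ≤ a * (b * e) := by rw [← mul_assoc]; omega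
    exact Nat.le_of_mul_le_mul_left h3 h.ha
  · apply le_degreeOf_single
    rw [h.coeff0]; exact h.hc

theorem KF.deg1 {a b e : ℕ} {c μ : k} {u : MvPolynomial (Fin 2) k} (h : KF a b e c μ u) :
    degreeOf 1 u = a * e := by
  apply le_antisymm
  · rw [degreeOf_le_iff]
    intro m hm
    have h1 := h.le m (mem_support_iff.1 hm)
    simp only [wt] at h1
    have h2 : a * m 0 + b * m 1 ≤ a * b * e := by exact_mod_cast h1
    have h3 : b * m 1 ≤ b * (a * e) := by rw [← mul_assoc, mul_comm b a]; omega
    exact Nat.le_of_mul_le_mul_left h3 h.hb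
  · apply le_degreeOf_single
    rw [h.coeff1]; exact mul_ne_zero h.hc (pow_ne_zero _ (neg_ne_zero.2 h.hμ))

/-- the elementary reduction -/
theorem KF.red {b e : ℕ} {c μ : k} {u : MvPolynomial (Fin 2) k} (h : KF 1 b e c μ u) :
    degreeOf 0 (E (Polynomial.C μ⁻¹ * Polynomial.X ^ b) u) < b * e := by
  set p : Polynomial k := Polynomial.C μ⁻¹ * Polynomial.X ^ b with hp
  have hz : E p (X 1) = X 1 + C μ⁻¹ * X 0 ^ b := by
    rw [E_X1, hp, map_mul, map_pow, Polynomial.aeval_X, Polynomial.aeval_C]; rfl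
  have h1 : E p (u - C c * (X 0 ^ b - C μ * X 1 ^ 1) ^ e) = E p u - C (c * (-μ) ^ e) * X 1 ^ e := by
    have hC : ∀ x : k, E p (C x) = C x := fun x => (E p).commutes x
    simp only [map_sub, map_mul, map_pow, hC, hz, E_X0, pow_one]
    have : (X 0 ^ b - C μ * (X 1 + C μ⁻¹ * X 0 ^ b) : MvPolynomial (Fin 2) k) = C (-μ) * X 1 := by
      have h2 : (C μ * C μ⁻¹ : MvPolynomial (Fin 2) k) = 1 := by
        rw [← C_mul, mul_inv_cancel₀ h.hμ, C_1]
      rw [mul_add, ← mul_assoc, h2, C_neg]; ring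
    rw [this, mul_pow, C_neg]; ring
  have h2 : Le 1 b (b * e - 1) (E p u - C (c * (-μ) ^ e) * X 1 ^ e) := by
    rw [← h1]
    have hr := h.rem
    simp only [Nat.cast_one, one_mul] at hr
    refine Le_hom (E p).toAlgHom ?_ ?_ hr
    · show Le 1 b 1 (E p (X 0)); rw [E_X0]; exact Hm_Le Hm_X0
    · show Le 1 b b (E p (X 1)); rw [hz]
      refine Sp_add (Hm_Le Hm_X1) ?_
      have := Hm_Le (Hm_mul (Hm_C (a := 1) (b := b) μ⁻¹) (Hm_pow (Hm_X0 (k := k) (a := 1) (b := b)) b))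
      rw [zero_add, mul_one] at this
      exact this
  have hbe : 0 < b * e := Nat.mul_pos h.hb h.he
  have h3 : degreeOf 0 (E p u) ≤ b * e - 1 := by
    rw [← Le_degreeOf0]
    have h4 : Le 1 0 ((b * e - 1 : ℕ) : ℤ) (E p u - C (c * (-μ) ^ e) * X 1 ^ e) := by
      refine Sp_mono (fun m hm => ?_) h2
      simp only [wt] at hm ⊢
      have : (0 : ℤ) ≤ b * m 1 := by positivity
      push_cast [Nat.cast_sub hbe]
      omega
    have h5 : Le 1 0 ((b * e - 1 : ℕ) : ℤ) (C (c * (-μ) ^ e) * X 1 ^ e : MvPolynomial (Fin 2) k) := by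
      have := Hm_Le (Hm_mul (Hm_C (a := 1) (b := 0) (c * (-μ) ^ e)) (Hm_pow (Hm_X1 (k := k) (a := 1) (b := 0)) e))
      refine Le_mono ?_ this
      simp
    have := Sp_add h4 h5
    rwa [sub_add_cancel] at this
  omega

theorem key_form' [CharZero k] [IsAlgClosed k]
    {d : Derivation k (MvPolynomial (Fin 2) k) (MvPolynomial (Fin 2) k)}
    (hd : IsLND d) (h0 : d (X 0) ≠ 0) (h1 : d (X 1) ≠ 0)
    {u : MvPolynomial (Fin 2) k} (hu : d u = 0) (hnc : ∀ c, u ≠ C c) :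
    ∃ (a b e : ℕ) (c μ : k), KF a b e c μ u := by
  obtain ⟨a, b, e, c, μ, h1, h2, h3, h4, h5, h6, h7, h8⟩ := key_form hd h0 h1 hu hnc
  exact ⟨a, b, e, c, μ, h1, h2, h3, h4, h5, h6, h7, h8⟩

end Aut

open MvPolynomial

section Phase1
variable {k : Type*} [Field k]

theorem conj_Sw_Sw (d : Derivation k (MvPolynomial (Fin 2) k) (MvPolynomial (Fin 2) k)) :
    conj Sw (conj Sw d) = d := by
  refine Derivation.ext fun f => ?_
  rw [conj_apply, conj_apply, Sw_symm, Sw_symm, Sw_Sw, Sw_Sw]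

theorem conj_E_E (h : Polynomial k)
    (d : Derivation k (MvPolynomial (Fin 2) k) (MvPolynomial (Fin 2) k)) :
    conj (E (-h)) (conj (E h) d) = d := by
  have e0 : ∀ f, E (0 : Polynomial k) f = f := fun f => by rw [E_apply, Eh_zero]; rfl
  refine Derivation.ext fun f => ?_
  rw [conj_apply, conj_apply, E_symm (-h), neg_neg, E_symm, ← E_apply, ← E_apply, E_add, E_add,
    neg_add_cancel, e0, e0]

theorem E_neg_E (h : Polynomial k) (f : MvPolynomial (Fin 2) k) : E (-h) (E h f) = f := by
  rw [E_add, neg_add_cancel, E_apply, Eh_zero]; rfl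

theorem Sp_hom_C (σ : MvPolynomial (Fin 2) k ≃ₐ[k] MvPolynomial (Fin 2) k) (c : k) :
    σ (C c) = C c := σ.commutes c

theorem nonconst_map (σ : MvPolynomial (Fin 2) k ≃ₐ[k] MvPolynomial (Fin 2) k)
    {u : MvPolynomial (Fin 2) k} (h : ∀ c, u ≠ C c) : ∀ c, σ u ≠ C c := by
  intro c hc
  rw [← Sp_hom_C σ] at hc
  exact h c (σ.injective hc)

theorem X_ne_C {ι : Type*} (i : ι) (c : k) : (X i : MvPolynomial ι k) ≠ C c := by
  classical
  intro h
  have := congrArg (coeff (Finsupp.single i 1)) h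
  have h0 : ¬ ((0 : ι →₀ ℕ) = Finsupp.single i 1) := by
    intro h'
    have := DFunLike.congr_fun h' i
    simp at this
  rw [coeff_X, coeff_C, if_neg h0] at this
  simp at this

theorem KF.swap {a b e : ℕ} {c μ : k} {u : MvPolynomial (Fin 2) k} (h : KF a b e c μ u) :
    KF b a e (c * (-μ) ^ e) μ⁻¹ (Sw u) := by
  have key : ∀ n : ℤ, ∀ f : MvPolynomial (Fin 2) k, Le a b n f → Le b a n (Sw f) := by
    intro n f hf
    refine Le_hom (Sw : MvPolynomial (Fin 2) k ≃ₐ[k] _).toAlgHom ?_ ?_ hf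
    · show Le b a a (Sw (X 0)); rw [Sw_X0]; exact Hm_Le Hm_X1
    · show Le b a b (Sw (X 1)); rw [Sw_X1]; exact Hm_Le Hm_X0
  refine ⟨h.hb, h.ha, h.he, mul_ne_zero h.hc (pow_ne_zero _ (neg_ne_zero.2 h.hμ)),
    inv_ne_zero h.hμ, h.hab.symm, ?_, ?_⟩
  · rw [mul_comm (b : ℤ) a]; exact key _ _ h.le
  · rw [mul_comm (b : ℤ) a]
    have := key _ _ h.rem
    convert this using 1
    simp only [map_sub, map_mul, map_pow, Sp_hom_C, Sw_X0, Sw_X1]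
    congr 1
    have h2 : (C μ * C μ⁻¹ : MvPolynomial (Fin 2) k) = 1 := by
      rw [← C_mul, mul_inv_cancel₀ h.hμ, C_1]
    have h3 : (X 1 ^ b - C μ * X 0 ^ a : MvPolynomial (Fin 2) k) =
        C (-μ) * (X 0 ^ a - C μ⁻¹ * X 1 ^ b) := by
      rw [C_neg, neg_mul, mul_sub, ← mul_assoc, h2]; ring
    rw [h3, mul_pow]; ring

theorem base0 {d : Derivation k (MvPolynomial (Fin 2) k) (MvPolynomial (Fin 2) k)}
    (hirr : IsIrred d) (h0 : d (X 0) = 0) : ∃ c, c ≠ 0 ∧ d (X 1) = C c := by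
  rw [irred_iff] at hirr
  have hu := hirr (d (X 1)) (fun g => by
    rw [der_eq d g, h0, mul_zero, zero_add]; exact Dvd.intro_left _ rfl)
  obtain ⟨c, hc, h⟩ := MvPolynomial.isUnit_iff_eq_C_of_isReduced.1 hu
  exact ⟨c, hc.ne_zero, h⟩

theorem base1 {d : Derivation k (MvPolynomial (Fin 2) k) (MvPolynomial (Fin 2) k)}
    (hirr : IsIrred d) (h0 : d (X 1) = 0) : ∃ c, c ≠ 0 ∧ d (X 0) = C c := by
  rw [irred_iff] at hirr
  have hu := hirr (d (X 0)) (fun g => by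
    rw [der_eq d g, h0, mul_zero, add_zero]; exact Dvd.intro_left _ rfl)
  obtain ⟨c, hc, h⟩ := MvPolynomial.isUnit_iff_eq_C_of_isReduced.1 hu
  exact ⟨c, hc.ne_zero, h⟩

theorem exists_JF [CharZero k] [IsAlgClosed k] (N : ℕ) :
    ∀ (d : Derivation k (MvPolynomial (Fin 2) k) (MvPolynomial (Fin 2) k))
    (u : MvPolynomial (Fin 2) k), IsLND d → IsIrred d → d u = 0 → (∀ c, u ≠ C c) →
    degreeOf 0 u + degreeOf 1 u ≤ N → ∃ v γ, γ ≠ 0 ∧ JF d v γ := by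
  induction N using Nat.strong_induction_on with
  | _ N ih =>
  intro d u hd hirr hu hnc hN
  by_cases h0 : d (X 0) = 0
  · obtain ⟨c, hc, h⟩ := base0 hirr h0
    refine ⟨X 0, c, hc, fun g => ?_⟩
    rw [der_eq, h0, h]
    simp [jac2, pderiv_X, mul_comm]
  by_cases h1 : d (X 1) = 0
  · obtain ⟨c, hc, h⟩ := base1 hirr h1
    refine ⟨X 1, -c, neg_ne_zero.2 hc, fun g => ?_⟩
    rw [der_eq, h1, h]
    simp [jac2, pderiv_X, mul_comm]
  obtain ⟨a, b, e, c, μ, hK⟩ := key_form' hd h0 h1 hu hnc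
  rcases hK.hab with rfl | rfl
  · set p : Polynomial k := Polynomial.C μ⁻¹ * Polynomial.X ^ b with hp
    have hr := hK.red
    rw [← hK.deg0, ← hp] at hr
    obtain ⟨v, γ, hγ, hv⟩ := ih (degreeOf 0 (E p u) + degreeOf 1 (E p u))
      (by rw [E_degree1]; omega) (conj (E p) d) (E p u) (conj_lnd _ _ hd) (conj_irred _ _ hirr)
      (by rw [conj_apply', hu, map_zero]) (nonconst_map _ hnc) le_rfl
    refine ⟨E (-p) v, γ, hγ, ?_⟩
    have := JF_E (-p) hv
    rwa [conj_E_E] at this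
  · have hK' := hK.swap
    set p : Polynomial k := Polynomial.C (μ⁻¹)⁻¹ * Polynomial.X ^ a with hp
    have hr := hK'.red
    rw [← hK'.deg0, ← hp] at hr
    obtain ⟨v, γ, hγ, hv⟩ := ih (degreeOf 0 (E p (Sw u)) + degreeOf 1 (E p (Sw u)))
      (by
        rw [E_degree1]
        have := Sw_degrees u
        omega)
      (conj (E p) (conj Sw d)) (E p (Sw u)) (conj_lnd _ _ (conj_lnd _ _ hd))
      (conj_irred _ _ (conj_irred _ _ hirr))
      (by rw [conj_apply', conj_apply', hu, map_zero, map_zero])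
      (nonconst_map _ (nonconst_map _ hnc)) le_rfl
    refine ⟨Sw (E (-p) v), -γ, neg_ne_zero.2 hγ, ?_⟩
    have := JF_E (-p) hv
    rw [conj_E_E] at this
    have := JF_Sw this
    rwa [conj_Sw_Sw] at this

/-- existence of non-constant kernel elements -/
theorem exists_ker [CharZero k]
    {d : Derivation k (MvPolynomial (Fin 2) k) (MvPolynomial (Fin 2) k)} (hd : IsLND d) :
    ∃ u, d u = 0 ∧ ∀ c, u ≠ C c := by
  by_contra hcon
  push Not at hcon
  have hy : d (X 0) ≠ 0 := by
    intro h
    obtain ⟨c, hc⟩ := hcon _ h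
    exact X_ne_C _ _ hc
  obtain ⟨m, hm⟩ := ndeg_exists d hd (X_ne_zero (R := k) (0 : Fin 2))
  have hm1 := (ndeg_of_d d hm hy).1
  obtain ⟨m, rfl⟩ : ∃ m', m = m' + 1 := ⟨m - 1, by omega⟩
  set s := (⇑d)^[m] (X 0) with hs
  have hds : ndeg d s 1 := by
    constructor
    · have := hm.1
      rw [Function.iterate_succ_apply'] at this
      exact this
    · have := hm.2
      rw [Function.iterate_succ_apply', Function.iterate_succ_apply'] at this
      exact this
  have hall : ∀ n f, (⇑d)^[n] f = 0 → f ∈ Algebra.adjoin k {s} := by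
    intro n
    induction n with
    | zero =>
      intro f hf
      have : f = 0 := hf
      rw [this]; exact zero_mem _
    | succ n ih =>
      intro f hf
      have hp := ndeg_pow d hds n
      rw [mul_one] at hp
      obtain ⟨b, hb⟩ := hcon ((⇑d)^[n] f) (by rwa [← Function.iterate_succ_apply' (⇑d)])
      obtain ⟨b', hb'⟩ := hcon ((⇑d)^[n] (s ^ n)) (by
        rw [← Function.iterate_succ_apply' (⇑d)]; exact hp.2)
      have hb0 : b' ≠ 0 := by
        rintro rfl
        exact hp.1 (by rw [hb', C_0])
      have h1 : f = C (b / b') * s ^ n + (f - C (b / b') * s ^ n) := by ring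
      rw [h1]
      refine add_mem (mul_mem (Subalgebra.algebraMap_mem _ (b / b'))
        (pow_mem (Algebra.self_mem_adjoin_singleton k s) n)) (ih _ ?_)
      rw [sub_eq_add_neg, it_add, ← neg_mul, it_const_mul d (by simp), hb, hb', neg_mul,
        ← C_mul, div_mul_cancel₀ _ hb0, add_neg_cancel]
  have hsurj : Function.Surjective (Polynomial.aeval s : Polynomial k →ₐ[k] MvPolynomial (Fin 2) k) := by
    intro f
    obtain ⟨n, hn⟩ := hd f
    have := hall n f hn
    rw [Algebra.adjoin_singleton_eq_range_aeval] at this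
    exact this
  have hP : IsPrincipalIdealRing (MvPolynomial (Fin 2) k) :=
    IsPrincipalIdealRing.of_surjective _ hsurj
  obtain ⟨g, hg⟩ := (hP.principal (Ideal.span {X 0, X 1})).principal
  have hg' : Ideal.span {X 0, X 1} = Ideal.span {g} := hg
  have d0 : g ∣ X 0 := Ideal.mem_span_singleton.1 (hg' ▸ Ideal.subset_span (by simp))
  have d1 : g ∣ X 1 := Ideal.mem_span_singleton.1 (hg' ▸ Ideal.subset_span (by simp))
  rcases ((prime_X2 (k := k) 0).irreducible.dvd_iff).1 d0 with h | h
  · rw [Ideal.span_singleton_eq_top.2 h, Ideal.eq_top_iff_one, Ideal.mem_span_pair] at hg'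
    obtain ⟨a, b, hab⟩ := hg'
    have := congrArg (eval 0) hab
    simp at this
  · have := X_dvd_X.1 (h.dvd.trans d1)
    exact absurd this (by decide)

theorem exists_JF' [CharZero k] [IsAlgClosed k]
    {d : Derivation k (MvPolynomial (Fin 2) k) (MvPolynomial (Fin 2) k)} (hd : IsLND d)
    (hirr : IsIrred d) : ∃ u γ, γ ≠ 0 ∧ JF d u γ := by
  obtain ⟨u, hu, hnc⟩ := exists_ker hd
  exact exists_JF _ d u hd hirr hu hnc le_rfl

theorem Le_C_mul {a b n : ℤ} {c : k} (hc : c ≠ 0) {f : MvPolynomial (Fin 2) k} :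
    Le a b n (C c * f) ↔ Le a b n f := by
  unfold Le Sp
  refine forall_congr' fun m => ?_
  rw [coeff_C_mul]
  simp [hc]

/-- total degree of the potential -/
theorem deg_pot [CharZero k]
    {d : Derivation k (MvPolynomial (Fin 2) k) (MvPolynomial (Fin 2) k)}
    {u : MvPolynomial (Fin 2) k} {γ : k} (hγ : γ ≠ 0) (hJ : JF d u γ) {N : ℤ} (hN : 0 ≤ N)
    (h0 : Le 1 1 (N - 1) (d (X 0))) (h1 : Le 1 1 (N - 1) (d (X 1)))
    (hno : ¬ (Le 1 1 (N - 2) (d (X 0)) ∧ Le 1 1 (N - 2) (d (X 1)))) :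
    Le 1 1 N u ∧ ¬ Le 1 1 (N - 1) u := by
  have e0 : d (X 0) = C (-γ) * pderiv 1 u := by
    rw [hJ]; simp [jac2, pderiv_X]
  have e1 : d (X 1) = C γ * pderiv 0 u := by
    rw [hJ]; simp [jac2, pderiv_X]
  rw [e0, Le_C_mul (neg_ne_zero.2 hγ)] at h0 hno
  rw [e1, Le_C_mul hγ] at h1 hno
  constructor
  · intro m hm
    have main : ∀ i, m i ≠ 0 → Le 1 1 (N - 1) (pderiv i u) → wt 1 1 m ≤ N := by
      intro i hi h
      have h3 : m - Finsupp.single i 1 + Finsupp.single i 1 = m := by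
        apply tsub_add_cancel_of_le
        rw [Finsupp.single_le_iff]; omega
      have := h (m - Finsupp.single i 1) (by
        rw [coeff_pderiv, h3]
        exact mul_ne_zero hm (Nat.cast_add_one_ne_zero _))
      rw [← h3, wt_add]
      have h4 : wt 1 1 (Finsupp.single i 1) = 1 := by
        fin_cases i <;> simp [wt]
      omega
    by_cases m0 : m 0 = 0
    · by_cases m1 : m 1 = 0
      · simp [wt, m0, m1, hN]
      · exact main 1 m1 h0
    · exact main 0 m0 h1
  · intro h
    apply hno
    constructor
    · exact Sp_pderiv 1 (fun m h => by rw [wt_add] at h; simp [wt] at h ⊢; omega) h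
    · exact Sp_pderiv 0 (fun m h => by rw [wt_add] at h; simp [wt] at h ⊢; omega) h

end Phase1

open MvPolynomial

section ThmA
variable {k : Type*} [Field k]

/-- triangular output -/
def TT (d : Derivation k (MvPolynomial (Fin 2) k) (MvPolynomial (Fin 2) k))
    (x0 x1 : MvPolynomial (Fin 2) k) : Prop :=
  (∃ c : k, d x0 = C c) ∧ ∃ g : Polynomial k, d x1 = Polynomial.aeval x0 g

/-- normal form output -/
def NN (p q : ℕ) (d : Derivation k (MvPolynomial (Fin 2) k) (MvPolynomial (Fin 2) k))
    (x0 x1 : MvPolynomial (Fin 2) k) : Prop :=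
  ∃ (h F : Polynomial k) (α κ : k), h.Monic ∧ h.natDegree = q ∧ F.Monic ∧ F.natDegree = p ∧
    F.coeff 0 = 0 ∧ α ≠ 0 ∧ κ ≠ 0 ∧ d (x1 + Polynomial.aeval x0 h) = C κ ∧
    d (C α * x0 + Polynomial.aeval (x1 + Polynomial.aeval x0 h) F) = 0

theorem TT_conj {d : Derivation k (MvPolynomial (Fin 2) k) (MvPolynomial (Fin 2) k)}
    {x0 x1 : MvPolynomial (Fin 2) k} (σ : MvPolynomial (Fin 2) k ≃ₐ[k] MvPolynomial (Fin 2) k)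
    (h : TT (conj σ d) (σ x0) (σ x1)) : TT d x0 x1 := by
  obtain ⟨⟨c, hc⟩, g, hg⟩ := h
  rw [conj_apply'] at hc hg
  refine ⟨⟨c, σ.injective (by rw [hc, Sp_hom_C])⟩, g, σ.injective ?_⟩
  rw [hg]
  exact (Polynomial.aeval_algHom_apply σ.toAlgHom x0 g)

theorem NN_conj {d : Derivation k (MvPolynomial (Fin 2) k) (MvPolynomial (Fin 2) k)} {p q : ℕ}
    {x0 x1 : MvPolynomial (Fin 2) k} (σ : MvPolynomial (Fin 2) k ≃ₐ[k] MvPolynomial (Fin 2) k)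
    (h : NN p q (conj σ d) (σ x0) (σ x1)) : NN p q d x0 x1 := by
  obtain ⟨h, F, α, κ, h1, h2, h3, h4, h5, h6, h7, h8, h9⟩ := h
  refine ⟨h, F, α, κ, h1, h2, h3, h4, h5, h6, h7, ?_, ?_⟩
  · apply σ.injective
    rw [← conj_apply' σ d, map_add, Sp_hom_C, ← h8]
    congr 2
    exact (Polynomial.aeval_algHom_apply σ.toAlgHom x0 h).symm
  · apply σ.injective
    have e : σ (x1 + Polynomial.aeval x0 h) = σ x1 + Polynomial.aeval (σ x0) h := by
      rw [map_add]; congr 1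
      exact (Polynomial.aeval_algHom_apply σ.toAlgHom x0 h).symm
    rw [map_zero, ← conj_apply' σ d, map_add, map_mul, Sp_hom_C, ← h9, ← e]
    congr 2
    exact (Polynomial.aeval_algHom_apply σ.toAlgHom _ F).symm

theorem pol_of_Sp {f : MvPolynomial (Fin 2) k} (h : Sp (fun m => m 0 = 0) f) :
    f = Polynomial.aeval (X 1) (aeval ![(0 : Polynomial k), Polynomial.X] f) := by
  conv_lhs => rw [f.as_sum]
  conv_rhs => rw [f.as_sum]
  rw [map_sum, map_sum]
  refine Finset.sum_congr rfl fun m hm => ?_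
  have hm0 := h m (mem_support_iff.1 hm)
  rw [monomial_eq, Finsupp.prod_fintype _ _ (by simp)]
  simp only [Fin.prod_univ_two, hm0, pow_zero, one_mul, map_mul, map_pow, aeval_X, aeval_C,
    Matrix.cons_val_one, Polynomial.aeval_X]
  rw [Polynomial.algebraMap_eq, Polynomial.aeval_C]
  simp [algebraMap_eq]

theorem split_form {a : ℕ} (ha : 2 ≤ a) {u : MvPolynomial (Fin 2) k} (h : Le a 1 a u) :
    u = C (coeff (Finsupp.single 0 1) u) * X 0 +
      Polynomial.aeval (X 1) (aeval ![(0 : Polynomial k), Polynomial.X] u) := by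
  classical
  set α := coeff (Finsupp.single 0 1) u with hα
  have hs : Sp (fun m => m 0 = 0) (u - C α * X 0) := by
    intro m hm
    by_contra h0
    rw [coeff_sub, coeff_C_mul, coeff_X] at hm
    split_ifs at hm with hm1
    · rw [← hm1] at hm; simp [hα] at hm
    · rw [mul_zero, sub_zero] at hm
      have h2 := h m hm
      simp only [wt, one_mul] at h2
      have h3 : a * m 0 + m 1 ≤ a := by exact_mod_cast h2
      have h4 : m 0 = 1 := by
        have : m 0 < 2 := by
          by_contra h5
          have : a * 2 ≤ a * m 0 := Nat.mul_le_mul_left _ (by omega)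
          omega
        omega
      rw [h4] at h3
      exact hm1 (fin2_ext (by simp [h4]) (by simp; omega))
  have := pol_of_Sp hs
  simp only [map_sub, map_mul, aeval_X, Matrix.cons_val_zero, mul_zero, sub_zero] at this
  rw [← this]; ring

theorem monic_split {G : Polynomial k} {n : ℕ} (hn : 0 < n) (hG : G.natDegree = n) :
    ∃ (L : k) (F : Polynomial k), L ≠ 0 ∧ F.Monic ∧ F.natDegree = n ∧ F.coeff 0 = 0 ∧
      F = Polynomial.C L * (G - Polynomial.C (G.coeff 0)) := by
  set H := G - Polynomial.C (G.coeff 0) with hH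
  have h1 : H.natDegree = n := by rw [hH, Polynomial.natDegree_sub_C, hG]
  have h0 : H ≠ 0 := by rintro h; rw [h] at h1; simp at h1; omega
  have h2 : H.leadingCoeff ≠ 0 := Polynomial.leadingCoeff_ne_zero.2 h0
  refine ⟨H.leadingCoeff⁻¹, Polynomial.C H.leadingCoeff⁻¹ * H, inv_ne_zero h2, ?_, ?_, ?_, rfl⟩
  · rw [mul_comm]; exact Polynomial.monic_mul_leadingCoeff_inv h0
  · rw [Polynomial.natDegree_C_mul (inv_ne_zero h2), h1]
  · rw [Polynomial.coeff_C_mul, hH]; simp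

theorem JF_ker {d : Derivation k (MvPolynomial (Fin 2) k) (MvPolynomial (Fin 2) k)}
    {u : MvPolynomial (Fin 2) k} {γ : k} (h : JF d u γ) : d u = 0 := by
  rw [h, jac2, mul_comm (pderiv 0 u), sub_self, mul_zero]

theorem TT_of_X1 {d : Derivation k (MvPolynomial (Fin 2) k) (MvPolynomial (Fin 2) k)}
    (hirr : IsIrred d) (h : d (X 0) = 0 ∨ d (X 1) = 0) : TT d (X 0) (X 1) := by
  rcases h with h | h
  · obtain ⟨c, hc, h'⟩ := base0 hirr h
    exact ⟨⟨0, by rw [h, C_0]⟩, Polynomial.C c, by rw [h', Polynomial.aeval_C]; rfl⟩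
  · obtain ⟨c, hc, h'⟩ := base1 hirr h
    exact ⟨⟨c, h'⟩, 0, by rw [h, map_zero]⟩

theorem two_primes {p q b a e : ℕ} (hp : p.Prime) (hq : q.Prime) (hb : 2 ≤ b) (ha : 2 ≤ a)
    (h : b * (a * e) = p * q) : e = 1 ∧ ((a = p ∧ b = q) ∨ (a = q ∧ b = p)) := by
  have hb' : b ∣ p * q := ⟨_, h.symm⟩
  have key : ∀ {p q : ℕ}, p.Prime → q.Prime → b * (a * e) = p * q → p ∣ b →
      e = 1 ∧ ((a = p ∧ b = q) ∨ (a = q ∧ b = p)) := by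
    intro p q hp hq h hpb
    obtain ⟨c, rfl⟩ := hpb
    have h1 : c * (a * e) = q := by
      apply Nat.eq_of_mul_eq_mul_left hp.pos
      rw [← h]; ring
    have h2 : a ∣ q := ⟨c * e, by rw [← h1]; ring⟩
    have h3 : a = q := by
      rcases (Nat.dvd_prime hq).1 h2 with h | h
      · omega
      · exact h
    have h4 : c * e = 1 := by
      apply Nat.eq_of_mul_eq_mul_left hq.pos
      rw [mul_one, ← h3]
      conv_rhs => rw [h3, ← h1]
      ring
    have h5 : c = 1 ∧ e = 1 := ⟨Nat.eq_one_of_mul_eq_one_right h4, Nat.eq_one_of_mul_eq_one_left h4⟩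
    refine ⟨h5.2, Or.inr ⟨h3, by rw [h5.1, mul_one]⟩⟩
  by_cases h1 : p ∣ b
  · exact key hp hq h h1
  by_cases h2 : q ∣ b
  · have := key hq hp (by rw [h, mul_comm]) h2
    tauto
  · exfalso
    have c1 : Nat.Coprime b p := ((Nat.Prime.coprime_iff_not_dvd hp).2 h1).symm
    have c2 : Nat.Coprime b q := ((Nat.Prime.coprime_iff_not_dvd hq).2 h2).symm
    have := Nat.Coprime.eq_one_of_dvd (Nat.Coprime.mul_right c1 c2) hb'
    omega

set_option maxHeartbeats 2000000 in
theorem thmA_core [CharZero k] [IsAlgClosed k]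
    {d : Derivation k (MvPolynomial (Fin 2) k) (MvPolynomial (Fin 2) k)}
    (hd : IsLND d) (hirr : IsIrred d) {u : MvPolynomial (Fin 2) k} {γ : k} (hγ : γ ≠ 0)
    (hJ : JF d u γ) {p q : ℕ} (hp : p.Prime) (hq : q.Prime)
    (h0 : degreeOf 0 u = p * q) (h1 : degreeOf 1 u < p * q) :
    ∃ s : k, s ≠ 0 ∧ (TT d (X 0) (C s * X 1) ∨ NN p q d (X 0) (C s * X 1) ∨
      NN q p d (X 0) (C s * X 1)) := by
  classical
  have hpq : 4 ≤ p * q := Nat.mul_le_mul hp.two_le hq.two_le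
  have hu := JF_ker hJ
  have hnc : ∀ c, u ≠ C c := by
    rintro c rfl
    rw [degreeOf_C] at h0; omega
  have hTT : TT d (X 0) (X 1) → ∃ s : k, s ≠ 0 ∧ (TT d (X 0) (C s * X 1) ∨
      NN p q d (X 0) (C s * X 1) ∨ NN q p d (X 0) (C s * X 1)) := by
    intro h
    refine ⟨1, one_ne_zero, Or.inl ?_⟩
    rwa [C_1, one_mul]
  by_cases hy : d (X 0) = 0
  · exact hTT (TT_of_X1 hirr (Or.inl hy))
  by_cases hz : d (X 1) = 0
  · exact hTT (TT_of_X1 hirr (Or.inr hz))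
  obtain ⟨a, b, e, c, μ, hK⟩ := key_form' hd hy hz hu hnc
  have k0 := hK.deg0
  have k1 := hK.deg1
  have hc0 := hK.coeff0
  have hb1 : b ≠ 1 := by
    rintro rfl
    have : 1 * e ≤ a * e := Nat.mul_le_mul_right _ hK.ha
    omega
  have ha1 : a = 1 := hK.hab.resolve_right hb1
  subst ha1
  have hb2 : 2 ≤ b := by have := hK.hb; omega
  -- minimise
  have hex : ∃ m : ℕ, ∃ h : Polynomial k, degreeOf 0 (E h u) = m := ⟨_, 0, rfl⟩
  obtain ⟨h, hh⟩ := Nat.find_spec hex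
  have hmin : ∀ g : Polynomial k, degreeOf 0 (E h u) ≤ degreeOf 0 (E g u) := by
    intro g
    rw [hh]
    exact Nat.find_min' hex ⟨g, rfl⟩
  set d1 := conj (E h) d with hd1
  set u1 := E h u with hu1
  have hd1L : IsLND d1 := conj_lnd _ _ hd
  have hd1I : IsIrred d1 := conj_irred _ _ hirr
  have hJ1 : JF d1 u1 γ := JF_E h hJ
  have b0 : E h (d (X 0)) = d1 (X 0) := by rw [← conj_apply', E_X0]
  have b1 : E h (d (X 1 - Polynomial.aeval (X 0) h)) = d1 (X 1) := by
    rw [← conj_apply', map_sub, E_X1, E_apply, Eh_pol, add_sub_cancel_right]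
  have hy1 : d1 (X 0) ≠ 0 := by
    intro h'
    rw [h'] at b0
    exact hy ((map_eq_zero_iff _ (E h).injective).1 b0)
  by_cases hz1 : d1 (X 1) = 0
  · apply hTT
    obtain ⟨c', hc', h'⟩ := base1 hd1I hz1
    have e0 : d (X 0) = C c' := (E h).injective (by rw [b0, h', Sp_hom_C])
    rw [hz1] at b1
    have e1 := (map_eq_zero_iff _ (E h).injective).1 b1
    rw [map_sub, sub_eq_zero] at e1
    refine ⟨⟨c', e0⟩, Polynomial.derivative h * Polynomial.C c', ?_⟩
    rw [e1, Derivation.map_aeval, e0, map_mul, Polynomial.aeval_C, smul_eq_mul]; rfl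
  obtain ⟨a', b', e', c', μ', hK'⟩ := key_form' hd1L hy1 hz1 (JF_ker hJ1) (nonconst_map _ hnc)
  have k0' := hK'.deg0
  have k1' := hK'.deg1
  rw [hu1, E_degree1, k1, one_mul] at k1'
  have ha' : a' ≠ 1 := by
    rintro rfl
    have r := hK'.red
    rw [← k0', hu1, E_add] at r
    have := hmin (Polynomial.C μ'⁻¹ * Polynomial.X ^ b' + h)
    rw [← hu1] at r
    omega
  have hb' : b' = 1 := hK'.hab.resolve_left ha'
  subst hb'
  have ha2 : 2 ≤ a' := by have := hK'.ha; omega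
  have hN : b * (a' * e') = p * q := by rw [← k1', ← k0, h0]
  obtain ⟨he1, hcases⟩ := two_primes hp hq hb2 ha2 hN
  subst he1
  -- shape of u1
  have hle := hK'.le
  simp only [Nat.cast_one, mul_one] at hle
  have hsplit := split_form ha2 hle
  have hα : coeff (Finsupp.single 0 1) u1 = c' := hK'.coeff0
  rw [hα] at hsplit
  set F := (aeval ![(0 : Polynomial k), Polynomial.X] u1 : Polynomial k) with hF
  have hFdeg : F.natDegree = a' := by
    apply Polynomial.natDegree_eq_of_le_of_coeff_ne_zero
    · rw [Polynomial.natDegree_le_iff_coeff_eq_zero]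
      intro n hn
      rw [hF, coeff_res1]
      by_contra hne
      have := hle _ hne
      simp [wt] at this
      omega
    · rw [hF, coeff_res1]
      have := hK'.coeff1
      rw [mul_one] at this
      rw [this]
      exact mul_ne_zero hK'.hc (pow_ne_zero _ (neg_ne_zero.2 hK'.hμ))
  have hu2 : u = C c' * X 0 + Polynomial.aeval (X 1 - Polynomial.aeval (X 0) h) F := by
    have : u = E (-h) u1 := by rw [hu1, E_neg_E]
    rw [this, hsplit, map_add, map_mul, Sp_hom_C, E_X0]
    congr 1
    have e2 : E (-h) (X 1) = X 1 - Polynomial.aeval (X 0) h := by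
      rw [E_X1, map_neg, sub_eq_add_neg]
    rw [← e2]
    exact (Polynomial.aeval_algHom_apply (E (-h)).toAlgHom _ F).symm
  have hres : (aeval ![Polynomial.X, (0 : Polynomial k)] u : Polynomial k) =
      Polynomial.C c' * Polynomial.X + F.comp (-h) := by
    rw [hu2, map_add, map_mul, aeval_C, aeval_X, ← Polynomial.aeval_algHom_apply, map_sub, aeval_X,
      ← Polynomial.aeval_algHom_apply, aeval_X]
    simp only [Matrix.cons_val_zero, Matrix.cons_val_one, Polynomial.aeval_X_left, zero_sub]
    rfl
  have hresdeg : (aeval ![Polynomial.X, (0 : Polynomial k)] u : Polynomial k).natDegree = p * q := by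
    apply Polynomial.natDegree_eq_of_le_of_coeff_ne_zero
    · rw [Polynomial.natDegree_le_iff_coeff_eq_zero]
      intro n hn
      rw [coeff_res0]
      by_contra hne
      have := le_degreeOf_single hne
      omega
    · rw [coeff_res0, ← h0, k0, hc0]
      exact hK.hc
  have hcomp : (F.comp (-h)).natDegree = p * q := by
    have e3 : F.comp (-h) = (aeval ![Polynomial.X, (0 : Polynomial k)] u : Polynomial k) -
        Polynomial.C c' * Polynomial.X := by rw [hres]; ring
    rw [e3, Polynomial.natDegree_sub_eq_left_of_natDegree_lt, hresdeg]
    rw [hresdeg]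
    refine lt_of_le_of_lt (b := 1) (by simpa using Polynomial.natDegree_C_mul_X_pow_le c' 1) (by omega)
  have hhdeg : h.natDegree = b := by
    rw [Polynomial.natDegree_comp, hFdeg, Polynomial.natDegree_neg, ← hN, mul_one, mul_comm b] at hcomp
    exact Nat.eq_of_mul_eq_mul_left (by omega) hcomp
  -- normalise
  have hh0 : h ≠ 0 := by rintro rfl; simp at hhdeg; omega
  set l := h.leadingCoeff with hl
  have hl0 : l ≠ 0 := Polynomial.leadingCoeff_ne_zero.2 hh0
  have hll : (C l * C l⁻¹ : MvPolynomial (Fin 2) k) = 1 := by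
    rw [← C_mul, mul_inv_cancel₀ hl0, C_1]
  set H := h * Polynomial.C l⁻¹ with hH
  have hHm : H.Monic := Polynomial.monic_mul_leadingCoeff_inv hh0
  have hHd : H.natDegree = b := by rw [hH, Polynomial.natDegree_mul_C (inv_ne_zero hl0), hhdeg]
  set t : MvPolynomial (Fin 2) k := C (-l⁻¹) * X 1 + Polynomial.aeval (X 0) H with ht
  have ht' : t = C (-l⁻¹) * (X 1 - Polynomial.aeval (X 0) h) := by
    rw [ht, hH, map_mul, Polynomial.aeval_C, C_neg, algebraMap_eq]; ring
  have ht2 : X 1 - Polynomial.aeval (X 0) h = C (-l) * t := by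
    rw [ht', ← mul_assoc, ← C_mul, neg_mul_neg, mul_inv_cancel₀ hl0, C_1, one_mul]
  set G := F.comp (Polynomial.C (-l) * Polynomial.X) with hG
  have hGt : Polynomial.aeval t G = Polynomial.aeval (X 1 - Polynomial.aeval (X 0) h) F := by
    rw [hG, Polynomial.aeval_comp, map_mul, Polynomial.aeval_C, Polynomial.aeval_X, ht2]; rfl
  have hGd : G.natDegree = a' := by
    rw [hG, Polynomial.natDegree_comp, hFdeg, Polynomial.natDegree_C_mul_X _ (neg_ne_zero.2 hl0), mul_one]
  obtain ⟨L, F', hL, hFm, hFd, hF0, hFe⟩ := monic_split (by omega) hGd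
  have hNN : NN a' b d (X 0) (C (-l⁻¹) * X 1) := by
    refine ⟨H, F', L * c', -l⁻¹ * (γ * c'), hHm, hHd, hFm, hFd, hF0, mul_ne_zero hL hK'.hc,
      mul_ne_zero (neg_ne_zero.2 (inv_ne_zero hl0)) (mul_ne_zero hγ hK'.hc), ?_, ?_⟩
    · rw [← ht, ht']
      have e4 : d1 (X 1) = C (γ * c') := by
        rw [hJ1]
        have : pderiv 0 u1 = C c' := by
          rw [hsplit, map_add, Derivation.map_aeval]
          simp [pderiv_X]
        simp [jac2, this, pderiv_X]
      have e5 : d (X 1 - Polynomial.aeval (X 0) h) = C (γ * c') :=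
        (E h).injective (by rw [b1, e4, Sp_hom_C])
      rw [Derivation.leibniz, e5, derivation_C, smul_eq_mul, smul_zero, add_zero, ← C_mul]
    · rw [← ht]
      have e6 : C (L * c') * X 0 + Polynomial.aeval t F' = C L * (u - C (G.coeff 0)) := by
        rw [hFe, C_mul, map_mul (Polynomial.aeval t), map_sub, Polynomial.aeval_C, Polynomial.aeval_C, hGt, algebraMap_eq, hu2]
        ring
      rw [e6, Derivation.leibniz, map_sub, hu]
      simp
  refine ⟨-l⁻¹, neg_ne_zero.2 (inv_ne_zero hl0), Or.inr ?_⟩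
  rcases hcases with ⟨r1, r2⟩ | ⟨r1, r2⟩
  · left; rw [r1, r2] at hNN; exact hNN
  · right; rw [r1, r2] at hNN; exact hNN

/-- Theorem A: structure of planar derivations -/
theorem thmA [CharZero k] [IsAlgClosed k]
    {d : Derivation k (MvPolynomial (Fin 2) k) (MvPolynomial (Fin 2) k)}
    (hd : IsLND d) (hirr : IsIrred d) {p q : ℕ} (hp : p.Prime) (hq : q.Prime)
    (h0 : Le 1 1 ((p * q : ℕ) - 1) (d (X 0))) (h1 : Le 1 1 ((p * q : ℕ) - 1) (d (X 1)))
    (hno : ¬ (Le 1 1 ((p * q : ℕ) - 2) (d (X 0)) ∧ Le 1 1 ((p * q : ℕ) - 2) (d (X 1)))) :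
    ∃ a b c e : k, a * e - b * c ≠ 0 ∧
      (TT d (C a * X 0 + C b * X 1) (C c * X 0 + C e * X 1) ∨
       NN p q d (C a * X 0 + C b * X 1) (C c * X 0 + C e * X 1) ∨
       NN q p d (C a * X 0 + C b * X 1) (C c * X 0 + C e * X 1)) := by
  obtain ⟨u, γ, hγ, hJ⟩ := exists_JF' hd hirr
  have hpq : 4 ≤ p * q := Nat.mul_le_mul hp.two_le hq.two_le
  obtain ⟨hle, hnle⟩ := deg_pot hγ hJ (N := (p * q : ℕ)) (by positivity) h0 h1 hno
  have hu := JF_ker hJ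
  have hnc : ∀ c, u ≠ C c := by
    rintro c rfl
    apply hnle
    refine Le_mono ?_ (Hm_Le (Hm_C c))
    omega
  by_cases hyz : d (X 0) = 0 ∨ d (X 1) = 0
  · refine ⟨1, 0, 0, 1, by simp, Or.inl ?_⟩
    have := TT_of_X1 hirr hyz
    simpa using this
  push Not at hyz
  obtain ⟨a, b, e, c, μ, hK⟩ := key_form' hd hyz.1 hyz.2 hu hnc
  -- total degree
  have t0 : b * e ≤ p * q := by
    have := hle _ (by rw [hK.coeff0]; exact hK.hc)
    simp [wt] at this
    exact_mod_cast this
  have t1 : a * e ≤ p * q := by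
    have := hle _ (by rw [hK.coeff1]; exact mul_ne_zero hK.hc (pow_ne_zero _ (neg_ne_zero.2 hK.hμ)))
    simp [wt] at this
    exact_mod_cast this
  have t2 : p * q ≤ a * b * e := by
    by_contra hlt
    apply hnle
    intro m hm
    have h2 := hK.le m hm
    simp only [wt] at h2 ⊢
    have h3 : a * m 0 + b * m 1 ≤ a * b * e := by exact_mod_cast h2
    have h4 : m 0 ≤ a * m 0 := Nat.le_mul_of_pos_left _ hK.ha
    have h5 : m 1 ≤ b * m 1 := Nat.le_mul_of_pos_left _ hK.hb
    push_cast at *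
    omega
  have hSwJ := JF_Sw hJ
  by_cases hab : a = 1 ∧ b = 1
  · obtain ⟨rfl, rfl⟩ := hab
    have he : e = p * q := by omega
    set g : Polynomial k := Polynomial.C μ⁻¹ * Polynomial.X ^ 1 with hg
    have hr := hK.red
    rw [← hg] at hr
    have hs := Sw_degrees (E g u)
    have hd1 := E_degree1 g u
    have k1 := hK.deg1
    obtain ⟨s, hs0, hs⟩ := thmA_core (conj_lnd Sw _ (conj_lnd (E g) _ hd))
      (conj_irred Sw _ (conj_irred (E g) _ hirr)) (neg_ne_zero.2 hγ) (JF_Sw (JF_E g hJ)) hp hq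
      (by omega) (by omega)
    have e0 : Sw (E g (C (-μ⁻¹) * X 0 + C 1 * X 1)) = (X 0 : MvPolynomial (Fin 2) k) := by
      rw [map_add, map_mul, map_mul, Sp_hom_C, Sp_hom_C, E_X0, E_X1, hg, map_mul, map_pow,
        Polynomial.aeval_C, Polynomial.aeval_X, algebraMap_eq]
      simp [Sp_hom_C, Sw_X0, Sw_X1]
    have e1 : Sw (E g (C s * X 0 + C 0 * X 1)) = (C s * X 1 : MvPolynomial (Fin 2) k) := by
      rw [C_0, zero_mul, add_zero, map_mul, Sp_hom_C, E_X0, map_mul, Sp_hom_C, Sw_X0]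
    rw [← e0, ← e1] at hs
    refine ⟨-μ⁻¹, 1, s, 0, by simpa using hs0, ?_⟩
    rcases hs with hs | hs | hs
    · exact Or.inl (TT_conj _ (TT_conj _ hs))
    · exact Or.inr (Or.inl (NN_conj _ (NN_conj _ hs)))
    · exact Or.inr (Or.inr (NN_conj _ (NN_conj _ hs)))
  rcases hK.hab with rfl | rfl
  · have hb2 : 2 ≤ b := by have := hK.hb; omega
    have k0 := hK.deg0
    have k1 := hK.deg1
    have : 2 * e ≤ b * e := Nat.mul_le_mul_right _ hb2
    have := hK.he
    rw [one_mul] at t2 k1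
    obtain ⟨s, hs0, hs⟩ := thmA_core hd hirr hγ hJ hp hq (by omega) (by omega)
    refine ⟨1, 0, 0, s, by simpa using hs0, ?_⟩
    simpa using hs
  · have hb2 : 2 ≤ a := by have := hK.ha; omega
    have k0 := hK.deg0
    have k1 := hK.deg1
    have hs := Sw_degrees u
    have : 2 * e ≤ a * e := Nat.mul_le_mul_right _ hb2
    have := hK.he
    rw [mul_one] at t2
    obtain ⟨s, hs0, hs⟩ := thmA_core (conj_lnd Sw _ hd) (conj_irred Sw _ hirr) (neg_ne_zero.2 hγ)
      hSwJ hp hq (by omega) (by omega)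
    have e0 : Sw (C 0 * X 0 + C 1 * X 1) = (X 0 : MvPolynomial (Fin 2) k) := by
      simp [Sw_X1]
    have e1 : Sw (C s * X 0 + C 0 * X 1) = (C s * X 1 : MvPolynomial (Fin 2) k) := by
      simp [Sw_X0, Sp_hom_C]
    rw [← e0, ← e1] at hs
    refine ⟨0, 1, s, 0, by simpa using hs0, ?_⟩
    rcases hs with hs | hs | hs
    · exact Or.inl (TT_conj _ hs)
    · exact Or.inr (Or.inl (NN_conj _ hs))
    · exact Or.inr (Or.inr (NN_conj _ hs))

end ThmA

open MvPolynomial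

section Lin
variable {k : Type*} [Field k]

/-- linear forms given by the rows of a matrix -/
noncomputable def lin (M : Matrix (Fin 3) (Fin 3) k) (i : Fin 3) : MvPolynomial (Fin 3) k :=
  ∑ j, C (M i j) * X j

theorem lin_hom (M : Matrix (Fin 3) (Fin 3) k) (i : Fin 3) : (lin M i).IsHomogeneous 1 := by
  refine IsHomogeneous.sum _ _ _ fun j _ => ?_
  have := (isHomogeneous_C (Fin 3) (M i j)).mul (isHomogeneous_X k j)
  simpa using this

theorem lin_one (i : Fin 3) : lin (1 : Matrix (Fin 3) (Fin 3) k) i = X i := by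
  classical
  unfold lin
  rw [Finset.sum_eq_single i]
  · simp
  · intro j _ hj
    rw [Matrix.one_apply_ne hj.symm]; simp
  · simp

theorem aeval_lin (M N : Matrix (Fin 3) (Fin 3) k) (i : Fin 3) :
    aeval (lin M) (lin N i) = lin (N * M) i := by
  unfold lin
  simp only [map_sum, map_mul, aeval_C, aeval_X, Matrix.mul_apply, Finset.mul_sum, Finset.sum_mul]
  rw [Finset.sum_comm]
  refine Finset.sum_congr rfl fun j _ => Finset.sum_congr rfl fun l _ => ?_
  rw [algebraMap_eq, mul_assoc]

/-- linear automorphism -/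
noncomputable def linE (M : Matrix (Fin 3) (Fin 3) k) (h : IsUnit M.det) :
    MvPolynomial (Fin 3) k ≃ₐ[k] MvPolynomial (Fin 3) k :=
  AlgEquiv.ofAlgHom (aeval (lin M)) (aeval (lin M⁻¹))
    (by
      ext i
      simp only [AlgHom.comp_apply, aeval_X, AlgHom.id_apply]
      rw [aeval_lin, Matrix.nonsing_inv_mul _ h, lin_one])
    (by
      ext i
      simp only [AlgHom.comp_apply, aeval_X, AlgHom.id_apply]
      rw [aeval_lin, Matrix.mul_nonsing_inv _ h, lin_one])

theorem linE_apply (M : Matrix (Fin 3) (Fin 3) k) (h : IsUnit M.det) (f : MvPolynomial (Fin 3) k) :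
    linE M h f = aeval (lin M) f := rfl

theorem linE_symm_apply (M : Matrix (Fin 3) (Fin 3) k) (h : IsUnit M.det)
    (f : MvPolynomial (Fin 3) k) : (linE M h).symm f = aeval (lin M⁻¹) f := rfl

theorem linE_X (M : Matrix (Fin 3) (Fin 3) k) (h : IsUnit M.det) (i : Fin 3) :
    linE M h (X i) = lin M i := by rw [linE_apply, aeval_X]

theorem lin_coord (M : Matrix (Fin 3) (Fin 3) k) (h : IsUnit M.det) : IsCoordSys (lin M) :=
  ⟨linE M h, linE_X M h⟩

theorem lin_of_hom {L : MvPolynomial (Fin 3) k} (h : L.IsHomogeneous 1) :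
    L = ∑ j, C (coeff (Finsupp.single j 1) L) * X j := by
  classical
  ext m
  rw [coeff_sum]
  simp only [coeff_C_mul, coeff_X]
  by_cases hm : m.degree = 1
  · obtain ⟨i, rfl⟩ : ∃ i, m = Finsupp.single i 1 := by
      have h0 : m ≠ 0 := by rintro rfl; simp at hm
      obtain ⟨i, hi⟩ := Finsupp.ne_iff.1 h0
      refine ⟨i, ?_⟩
      rw [Finsupp.degree_eq_sum] at hm
      have h1 := Finset.add_sum_erase Finset.univ (fun j => m j) (Finset.mem_univ i)
      simp only [Finsupp.coe_zero, Pi.zero_apply] at hi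
      have h2 : ∑ j ∈ Finset.univ.erase i, m j = 0 := by omega
      ext j
      by_cases hj : j = i
      · subst hj; simp; omega
      · rw [Finsupp.single_apply, if_neg (Ne.symm hj)]
        exact Finset.sum_eq_zero_iff.1 h2 j (Finset.mem_erase.2 ⟨hj, Finset.mem_univ _⟩)
    rw [Finset.sum_eq_single i]
    · simp
    · intro j _ hj
      rw [if_neg, mul_zero]
      intro h'
      exact hj (Finsupp.single_left_injective one_ne_zero h')
    · simp
  · rw [h.coeff_eq_zero hm]
    symm
    refine Finset.sum_eq_zero fun j _ => ?_
    rw [if_neg, mul_zero]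
    rintro rfl
    simp at hm

theorem exists_matrix {l : Fin 3 → k} (hl : l ≠ 0) :
    ∃ M : Matrix (Fin 3) (Fin 3) k, M.det = 1 ∧ ∀ j, M 0 j = l j := by
  obtain ⟨i, hi⟩ := Function.ne_iff.1 hl
  simp only [Pi.zero_apply] at hi
  fin_cases i
  · refine ⟨!![l 0, l 1, l 2; 0, 1, 0; 0, 0, (l 0)⁻¹], ?_, fun j => by fin_cases j <;> rfl⟩
    simp only [Fin.zero_eta] at hi
    simp [Matrix.det_fin_three, hi]
  · refine ⟨!![l 0, l 1, l 2; 0, 0, 1; (l 1)⁻¹, 0, 0], ?_, fun j => by fin_cases j <;> rfl⟩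
    simp only [Fin.mk_one] at hi
    simp [Matrix.det_fin_three, hi]
  · refine ⟨!![l 0, l 1, l 2; 1, 0, 0; 0, (l 2)⁻¹, 0], ?_, fun j => by fin_cases j <;> rfl⟩
    simp only [Fin.reduceFinMk] at hi
    simp [Matrix.det_fin_three, hi]

theorem exists_linear_ker {D : Derivation k (MvPolynomial (Fin 3) k) (MvPolynomial (Fin 3) k)}
    {m : ℕ} (hD : IsHomogDer D m) {V : Fin 3 → MvPolynomial (Fin 3) k} (hV : IsCoordSys V)
    (h2 : D (V 2) = 0) : ∃ M : Matrix (Fin 3) (Fin 3) k, M.det = 1 ∧ D (lin M 0) = 0 := by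
  classical
  set L := homogeneousComponent 1 (V 2) with hL
  have hLh : L.IsHomogeneous 1 := homogeneousComponent_isHomogeneous _ _
  have hDL : D L = 0 := by
    have e1 : homogeneousComponent (1 + m) (D (V 2)) = D L := by
      conv_lhs => rw [← sum_homogeneousComponent (V 2)]
      rw [map_sum, map_sum]
      have key : ∀ i, homogeneousComponent (1 + m) (D (homogeneousComponent i (V 2))) =
          if i = 1 then D L else 0 := by
        intro i
        have := hD i _ (homogeneousComponent_isHomogeneous i (V 2))
        rw [homogeneousComponent_of_mem ((mem_homogeneousSubmodule _ _).2 this)]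
        by_cases hi : i = 1
        · subst hi; simp [hL]
        · rw [if_neg hi, if_neg (by omega)]
      rw [Finset.sum_congr rfl fun i _ => key i]
      rw [Finset.sum_ite_eq']
      split_ifs with hmem
      · rfl
      · rw [hL, homogeneousComponent_eq_zero, map_zero]
        simp at hmem; omega
    rw [← e1, h2, map_zero]
  have hne : (fun j => coeff (Finsupp.single j 1) L) ≠ 0 := by
    intro h0
    obtain ⟨σ, hσ⟩ := hV
    have hc := chain (pderiv (2 : Fin 3)) σ.symm.toAlgHom (V 2)
    have e0 : σ.symm.toAlgHom (V 2) = X 2 := by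
      rw [← hσ 2]; exact σ.symm_apply_apply _
    rw [e0, pderiv_X_self] at hc
    have hc' := congrArg (fun f => constantCoeff (σ f)) hc
    simp only [map_one, map_sum, map_mul] at hc'
    refine one_ne_zero (hc'.trans (Finset.sum_eq_zero fun i _ => ?_))
    have e1 : σ (σ.symm.toAlgHom (pderiv i (V 2))) = pderiv i (V 2) := σ.apply_symm_apply _
    rw [e1, constantCoeff_eq, coeff_pderiv]
    have e2 := congrFun h0 i
    simp only [hL, Pi.zero_apply, coeff_homogeneousComponent] at e2
    rw [if_pos (by simp)] at e2
    rw [zero_add, e2, zero_mul, zero_mul]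
  obtain ⟨M, hM, hM0⟩ := exists_matrix hne
  refine ⟨M, hM, ?_⟩
  have : lin M 0 = L := by
    rw [lin_of_hom hLh]
    exact Finset.sum_congr rfl fun j _ => by rw [hM0]
  rw [this, hDL]

theorem homog_conj {D : Derivation k (MvPolynomial (Fin 3) k) (MvPolynomial (Fin 3) k)}
    {m : ℕ} (hD : IsHomogDer D m) (M : Matrix (Fin 3) (Fin 3) k) (h : IsUnit M.det) :
    IsHomogDer (conj (linE M h).symm D) m := by
  intro i f hf
  rw [conj_apply, AlgEquiv.symm_symm, linE_symm_apply, linE_apply]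
  have h1 := hf.aeval _ (lin_hom M)
  rw [one_mul] at h1
  have h2 := (hD _ _ h1).aeval _ (lin_hom M⁻¹)
  rwa [one_mul] at h2

end Lin

open MvPolynomial

section Dehom
variable {k : Type*} [Field k]

/-- dehomogenization -/
noncomputable def dh : MvPolynomial (Fin 3) k →ₐ[k] MvPolynomial (Fin 2) k :=
  aeval ![1, X 0, X 1]

theorem dh_X0 : dh (X 0 : MvPolynomial (Fin 3) k) = 1 := by simp [dh]
theorem dh_X1 : dh (X 1 : MvPolynomial (Fin 3) k) = X 0 := by simp [dh]
theorem dh_X2 : dh (X 2 : MvPolynomial (Fin 3) k) = X 1 := by simp [dh]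
theorem dh_C (c : k) : dh (C c : MvPolynomial (Fin 3) k) = C c := by
  simp [dh, algebraMap_eq]

/-- restriction of exponents -/
noncomputable def re (m : Fin 3 →₀ ℕ) : Fin 2 →₀ ℕ := Finsupp.single 0 (m 1) + Finsupp.single 1 (m 2)

theorem re0 (m : Fin 3 →₀ ℕ) : re m 0 = m 1 := by simp [re]
theorem re1 (m : Fin 3 →₀ ℕ) : re m 1 = m 2 := by simp [re]

theorem mon2 (a b : ℕ) (c : k) : (C c * X 0 ^ a * X 1 ^ b : MvPolynomial (Fin 2) k) =
    monomial (Finsupp.single 0 a + Finsupp.single 1 b) c := by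
  rw [X_pow_eq_monomial, X_pow_eq_monomial, C_mul_monomial, monomial_mul, mul_one, mul_one]

theorem dh_monomial (m : Fin 3 →₀ ℕ) (c : k) : dh (monomial m c) = monomial (re m) c := by
  rw [monomial_eq, Finsupp.prod_fintype _ _ (by simp), Fin.prod_univ_three, map_mul, map_mul,
    map_mul, map_pow, map_pow, map_pow, dh_C, dh_X0, dh_X1, dh_X2, one_pow, one_mul, ← mul_assoc,
    mon2]
  rfl

theorem dh_coeff (F : MvPolynomial (Fin 3) k) (s : Fin 2 →₀ ℕ) :
    coeff s (dh F) = ∑ m ∈ F.support, if re m = s then coeff m F else 0 := by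
  classical
  conv_lhs => rw [F.as_sum, map_sum, coeff_sum]
  refine Finset.sum_congr rfl fun m _ => ?_
  rw [dh_monomial, coeff_monomial]

theorem deg3 (m : Fin 3 →₀ ℕ) : m.degree = m 0 + m 1 + m 2 := by
  rw [Finsupp.degree_eq_sum, Fin.sum_univ_three]

theorem dh_inj0 {F : MvPolynomial (Fin 3) k} {n : ℕ} (hF : F.IsHomogeneous n) (h : dh F = 0) :
    F = 0 := by
  classical
  ext m
  rw [coeff_zero]
  by_contra hm
  have e := dh_coeff F (re m)
  rw [h, coeff_zero, Finset.sum_eq_single m] at e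
  · rw [if_pos rfl] at e; exact hm e.symm
  · intro m' hm' hne
    rw [if_neg]
    intro hre
    apply hne
    have d1 : m.degree = n := by by_contra h'; exact hm (hF.coeff_eq_zero h')
    have d2 : m'.degree = n := by
      by_contra h'; exact (mem_support_iff.1 hm') (hF.coeff_eq_zero h')
    rw [deg3] at d1 d2
    have r0 := DFunLike.congr_fun hre 0
    have r1 := DFunLike.congr_fun hre 1
    rw [re0, re0] at r0
    rw [re1, re1] at r1
    ext j
    fin_cases j
    · simp only [Fin.zero_eta]; omega
    · exact r0
    · exact r1
  · intro h'
    exact absurd (mem_support_iff.2 hm) h'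

theorem dh_inj {F G : MvPolynomial (Fin 3) k} {n : ℕ} (hF : F.IsHomogeneous n)
    (hG : G.IsHomogeneous n) (h : dh F = dh G) : F = G := by
  rw [← sub_eq_zero]
  exact dh_inj0 (hF.sub hG) (by rw [map_sub, h, sub_self])

theorem dh_Le {F : MvPolynomial (Fin 3) k} {n : ℕ} (hF : F.IsHomogeneous n) :
    Le 1 1 n (dh F) := by
  classical
  intro s hs
  rw [dh_coeff] at hs
  obtain ⟨m, hm, hne⟩ := Finset.exists_ne_zero_of_sum_ne_zero hs
  have hre : re m = s := by by_contra h; rw [if_neg h] at hne; exact hne rfl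
  have d2 : m.degree = n := by
    by_contra h'; exact (mem_support_iff.1 hm) (hF.coeff_eq_zero h')
  rw [deg3] at d2
  rw [← hre]
  simp only [wt, re0, re1]
  omega

theorem lift_exists {f : MvPolynomial (Fin 2) k} {n : ℕ} (h : Le 1 1 n f) :
    ∃ F : MvPolynomial (Fin 3) k, F.IsHomogeneous n ∧ dh F = f := by
  refine ⟨∑ m ∈ f.support, C (coeff m f) * X 0 ^ (n - m 0 - m 1) * X 1 ^ m 0 * X 2 ^ m 1, ?_, ?_⟩
  · refine IsHomogeneous.sum _ _ _ fun m hm => ?_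
    have h1 := h m (mem_support_iff.1 hm)
    simp only [wt] at h1
    have h2 : n = 0 + 1 * (n - m 0 - m 1) + 1 * m 0 + 1 * m 1 := by omega
    have := (((isHomogeneous_C (Fin 3) (coeff m f)).mul
      ((isHomogeneous_X k (0 : Fin 3)).pow (n - m 0 - m 1))).mul
      ((isHomogeneous_X k (1 : Fin 3)).pow (m 0))).mul ((isHomogeneous_X k (2 : Fin 3)).pow (m 1))
    rwa [← h2] at this
  · rw [map_sum]
    conv_rhs => rw [f.as_sum]
    refine Finset.sum_congr rfl fun m _ => ?_
    rw [map_mul, map_mul, map_mul, map_pow, map_pow, map_pow, dh_C, dh_X0, dh_X1, dh_X2, one_pow,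
      mul_one, mon2]
    rw [show (Finsupp.single 0 (m 0) + Finsupp.single 1 (m 1) : Fin 2 →₀ ℕ) = m from
      fin2_ext (by simp) (by simp)]

theorem Le_nat_exists (f : MvPolynomial (Fin 2) k) : ∃ n : ℕ, Le 1 1 n f := by
  obtain ⟨n, hn⟩ := Le_exists 1 1 f
  exact ⟨n.toNat, Le_mono (Int.self_le_toNat n) hn⟩

theorem hom_X0_mul {G : MvPolynomial (Fin 3) k} {n : ℕ} (hG : G ≠ 0)
    (h : (X 0 * G).IsHomogeneous n) : ∃ r, n = r + 1 ∧ G.IsHomogeneous r := by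
  classical
  have key : ∀ m, coeff m G ≠ 0 → m.degree + 1 = n := by
    intro m hm
    by_contra hne
    apply hm
    have := h.coeff_eq_zero (d := Finsupp.single 0 1 + m) (by rw [map_add]; simp; omega)
    rwa [coeff_X_mul] at this
  obtain ⟨m, hm⟩ := MvPolynomial.exists_coeff_ne_zero hG
  refine ⟨m.degree, (key m hm).symm, ?_⟩
  intro m' hm'
  have := key m' hm'
  have := key m hm
  have e : Finsupp.weight 1 m' = m'.degree := by
    rw [Finsupp.degree_eq_weight_one]; rfl
  omega

theorem X0_dvd {F : MvPolynomial (Fin 3) k} {n : ℕ} (hF : F.IsHomogeneous (n + 1))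
    (h : Le 1 1 n (dh F)) : X 0 ∣ F := by
  obtain ⟨G, hG, hGF⟩ := lift_exists h
  refine ⟨G, dh_inj hF ?_ (by rw [map_mul, dh_X0, one_mul, hGF])⟩
  have := (isHomogeneous_X k (0 : Fin 3)).mul hG
  rwa [add_comm 1 n] at this

theorem X0_hom_pow (n : ℕ) : (X 0 ^ n : MvPolynomial (Fin 3) k).IsHomogeneous n := by
  have := (isHomogeneous_X k (0 : Fin 3)).pow n
  rwa [one_mul] at this

variable (D : Derivation k (MvPolynomial (Fin 3) k) (MvPolynomial (Fin 3) k))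

/-- dehomogenized derivation -/
noncomputable def dD : Derivation k (MvPolynomial (Fin 2) k) (MvPolynomial (Fin 2) k) :=
  mkDerivation k ![dh (D (X 1)), dh (D (X 2))]

variable {D}

theorem dD_dh (h0 : D (X 0) = 0) (f : MvPolynomial (Fin 3) k) : dD D (dh f) = dh (D f) := by
  have h1 := chain D (AlgHom.id k _) f
  have h2 := chain (dD D) dh f
  simp only [AlgHom.id_apply, Fin.sum_univ_three] at h1 h2
  rw [h1, h2, h0, dh_X0, dh_X1, dh_X2]
  simp [dD, mkDerivation_X]

theorem dD_it (h0 : D (X 0) = 0) (n : ℕ) (f : MvPolynomial (Fin 3) k) :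
    (⇑(dD D))^[n] (dh f) = dh ((⇑D)^[n] f) := by
  induction n generalizing f with
  | zero => rfl
  | succ n ih => rw [Function.iterate_succ_apply, Function.iterate_succ_apply, dD_dh h0, ih]

theorem dD_lnd (h0 : D (X 0) = 0) (h : IsLND D) : IsLND (dD D) := by
  intro f
  obtain ⟨n, hn⟩ := Le_nat_exists f
  obtain ⟨F, -, rfl⟩ := lift_exists hn
  obtain ⟨m, hm⟩ := h F
  exact ⟨m, by rw [dD_it h0, hm, map_zero]⟩

theorem not_dvd_both (h0 : D (X 0) = 0) (h : IsIrred D) {b : MvPolynomial (Fin 3) k}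
    (h1 : b ∣ D (X 1)) (h2 : b ∣ D (X 2)) : IsUnit b := by
  refine (irred_iff D).1 h b fun g => ?_
  have e := chain D (AlgHom.id k _) g
  simp only [AlgHom.id_apply, Fin.sum_univ_three] at e
  rw [e, h0, mul_zero, zero_add]
  exact dvd_add (h1.mul_left _) (h2.mul_left _)

theorem X0_not_unit : ¬ IsUnit (X 0 : MvPolynomial (Fin 3) k) := (X_prime (R := k) (i := (0 : Fin 3))).not_isUnit

theorem lift_dvd {F Bh : MvPolynomial (Fin 3) k} {n s : ℕ} (hF : F.IsHomogeneous n)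
    (hB : Bh.IsHomogeneous s) (hX : ¬ X 0 ∣ Bh) (h : dh Bh ∣ dh F) : Bh ∣ F := by
  obtain ⟨c, hc⟩ := h
  obtain ⟨e, he⟩ := Le_nat_exists c
  obtain ⟨G, hG, rfl⟩ := lift_exists he
  have e1 : X 0 ^ (s + e) * F = X 0 ^ n * (Bh * G) := by
    refine dh_inj (n := s + e + n) ((X0_hom_pow _).mul hF) ?_ ?_
    · have := (X0_hom_pow (k := k) n).mul (hB.mul hG)
      rwa [add_comm n] at this
    · rw [map_mul, map_mul, map_mul, map_pow, map_pow, dh_X0, one_pow, one_pow, one_mul, one_mul, hc]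
  have hrel : IsRelPrime Bh (X 0 ^ (s + e)) :=
    (((X_prime (R := k) (i := (0 : Fin 3))).irreducible.isRelPrime_iff_not_dvd).2 hX).symm.pow_right
  refine hrel.dvd_of_dvd_mul_left ?_
  rw [e1]
  exact (dvd_mul_right Bh G).mul_left _

theorem dD_irred (h0 : D (X 0) = 0) (h : IsIrred D) {m : ℕ} (hD : IsHomogDer D m) :
    IsIrred (dD D) := by
  classical
  rw [irred_iff]
  intro b hb
  have hh1 := hD 1 _ (isHomogeneous_X k (1 : Fin 3))
  have hh2 := hD 1 _ (isHomogeneous_X k (2 : Fin 3))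
  have b1 : b ∣ dh (D (X 1)) := by rw [← dD_dh h0]; exact hb _
  have b2 : b ∣ dh (D (X 2)) := by rw [← dD_dh h0]; exact hb _
  have hb0 : b ≠ 0 := by
    rintro rfl
    rw [zero_dvd_iff] at b1 b2
    have c1 := dh_inj0 hh1 b1
    have c2 := dh_inj0 hh2 b2
    exact X0_not_unit (not_dvd_both h0 h (b := X 0) (by rw [c1]; exact dvd_zero _)
      (by rw [c2]; exact dvd_zero _))
  have hex := Le_nat_exists b
  obtain ⟨Bh, hBh, hBb⟩ := lift_exists (Nat.find_spec hex)
  have hX : ¬ X 0 ∣ Bh := by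
    rintro ⟨G, rfl⟩
    rw [map_mul, dh_X0, one_mul] at hBb
    have hG : G ≠ 0 := by rintro rfl; rw [map_zero] at hBb; exact hb0 hBb.symm
    obtain ⟨r, hr, hGh⟩ := hom_X0_mul hG hBh
    have := Nat.find_min' hex (m := r) (by rw [← hBb]; exact dh_Le hGh)
    omega
  have hu : IsUnit Bh := not_dvd_both h0 h (lift_dvd hh1 hBh hX (by rwa [hBb]))
    (lift_dvd hh2 hBh hX (by rwa [hBb]))
  rw [← hBb]
  exact hu.map dh

end Dehom

open MvPolynomial

section Pre
variable {k : Type*} [Field k]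

theorem aeval_scaleRoots {A : Type*} [CommRing A] [Algebra k A] (H : Polynomial k) (x : A) (s : k) :
    Polynomial.aeval (algebraMap k A s * x) (H.scaleRoots s) =
      algebraMap k A s ^ H.natDegree * Polynomial.aeval x H :=
  Polynomial.scaleRoots_eval₂_mul (algebraMap k A) x s

theorem NN_scale {d : Derivation k (MvPolynomial (Fin 2) k) (MvPolynomial (Fin 2) k)} {p q : ℕ}
    {x0 x1 : MvPolynomial (Fin 2) k} (h : NN p q d x0 x1) {μ : k} (hμ : μ ≠ 0) :
    NN p q d (C μ * x0) (C (μ ^ q) * x1) := by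
  obtain ⟨h, F, α, κ, h1, h2, h3, h4, h5, h6, h7, h8, h9⟩ := h
  have eT : C (μ ^ q) * x1 + Polynomial.aeval (C μ * x0) (h.scaleRoots μ) =
      C (μ ^ q) * (x1 + Polynomial.aeval x0 h) := by
    have := aeval_scaleRoots h x0 μ
    rw [algebraMap_eq, h2] at this
    rw [this, C_pow]; ring
  refine ⟨h.scaleRoots μ, F.scaleRoots (μ ^ q), α * μ ^ (q * p) * μ⁻¹, μ ^ q * κ,
    (Polynomial.monic_scaleRoots_iff _).2 h1, by rw [Polynomial.natDegree_scaleRoots, h2],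
    (Polynomial.monic_scaleRoots_iff _).2 h3, by rw [Polynomial.natDegree_scaleRoots, h4],
    by rw [Polynomial.coeff_scaleRoots, h5, zero_mul],
    mul_ne_zero (mul_ne_zero h6 (pow_ne_zero _ hμ)) (inv_ne_zero hμ),
    mul_ne_zero (pow_ne_zero _ hμ) h7, ?_, ?_⟩
  · rw [eT, Derivation.leibniz, h8, derivation_C, smul_zero, add_zero, smul_eq_mul, ← C_mul]
  · rw [eT]
    have := aeval_scaleRoots F (x1 + Polynomial.aeval x0 h) (μ ^ q)
    rw [algebraMap_eq, h4] at this
    rw [this]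
    have e2 : C (α * μ ^ (q * p) * μ⁻¹) * (C μ * x0) = C (μ ^ (q * p)) * (C α * x0) := by
      rw [← mul_assoc, ← mul_assoc, ← C_mul, ← C_mul]
      congr 2
      field_simp
    rw [e2, ← C_pow, ← pow_mul, ← mul_add, Derivation.leibniz, h9, derivation_C, smul_zero,
      smul_zero, add_zero]

theorem thmA2 [CharZero k] [IsAlgClosed k]
    {d : Derivation k (MvPolynomial (Fin 2) k) (MvPolynomial (Fin 2) k)}
    (hd : IsLND d) (hirr : IsIrred d) {p q : ℕ} (hp : p.Prime) (hq : q.Prime)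
    (h0 : Le 1 1 ((p * q : ℕ) - 1) (d (X 0))) (h1 : Le 1 1 ((p * q : ℕ) - 1) (d (X 1)))
    (hno : ¬ (Le 1 1 ((p * q : ℕ) - 2) (d (X 0)) ∧ Le 1 1 ((p * q : ℕ) - 2) (d (X 1)))) :
    ∃ a b c e : k, (a * e - b * c ≠ 0 ∧ TT d (C a * X 0 + C b * X 1) (C c * X 0 + C e * X 1)) ∨
      (a * e - b * c = 1 ∧
       (NN p q d (C a * X 0 + C b * X 1) (C c * X 0 + C e * X 1) ∨
       NN q p d (C a * X 0 + C b * X 1) (C c * X 0 + C e * X 1))) := by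
  obtain ⟨a, b, c, e, hne, h⟩ := thmA hd hirr hp hq h0 h1 hno
  have sc : ∀ q : ℕ, ∃ μ : k, μ ≠ 0 ∧ (μ * a) * (μ ^ q * e) - (μ * b) * (μ ^ q * c) = 1 := by
    intro q
    obtain ⟨μ, hμ⟩ := IsAlgClosed.exists_pow_nat_eq (a * e - b * c)⁻¹ (Nat.succ_pos q)
    refine ⟨μ, ?_, ?_⟩
    · rintro rfl
      rw [zero_pow (Nat.succ_ne_zero q)] at hμ
      exact inv_ne_zero hne hμ.symm
    · have : (μ * a) * (μ ^ q * e) - (μ * b) * (μ ^ q * c) = μ ^ q.succ * (a * e - b * c) := by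
        rw [pow_succ]; ring
      rw [this, hμ, inv_mul_cancel₀ hne]
  have re : ∀ (s x y : k), (C s * (C x * X 0 + C y * X 1) : MvPolynomial (Fin 2) k) =
      C (s * x) * X 0 + C (s * y) * X 1 := by
    intro s x y; rw [C_mul, C_mul]; ring
  rcases h with h | h | h
  · exact ⟨a, b, c, e, Or.inl ⟨hne, h⟩⟩
  · obtain ⟨μ, hμ, h1⟩ := sc q
    refine ⟨_, _, _, _, Or.inr ⟨h1, Or.inl ?_⟩⟩
    have := NN_scale h hμ
    rwa [re, re] at this
  · obtain ⟨μ, hμ, h1⟩ := sc p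
    refine ⟨_, _, _, _, Or.inr ⟨h1, Or.inr ?_⟩⟩
    have := NN_scale h hμ
    rwa [re, re] at this

/-- homogenization of a polynomial in one variable -/
noncomputable def hz (H : Polynomial k) (q : ℕ) : MvPolynomial (Fin 2) k :=
  ∑ i ∈ Finset.range (q + 1), C (H.coeff i) * X 0 ^ (q - i) * X 1 ^ i

theorem hz_hom (H : Polynomial k) (q : ℕ) : (hz H q).IsHomogeneous q := by
  refine IsHomogeneous.sum _ _ _ fun i hi => ?_
  rw [Finset.mem_range] at hi
  have h2 : q = 0 + 1 * (q - i) + 1 * i := by omega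
  have := (((isHomogeneous_C (Fin 2) (H.coeff i)).mul
      ((isHomogeneous_X k (0 : Fin 2)).pow (q - i))).mul
      ((isHomogeneous_X k (1 : Fin 2)).pow i))
  rwa [← h2] at this

theorem hz_coeff (H : Polynomial k) (q : ℕ) :
    coeff (Finsupp.single (1 : Fin 2) q) (hz H q) = H.coeff q := by
  classical
  rw [hz, coeff_sum, Finset.sum_eq_single q]
  · rw [mon2, coeff_monomial, if_pos]; simp
  · intro i _ hi
    rw [mon2, coeff_monomial, if_neg]
    intro h
    have := DFunLike.congr_fun h 1
    simp at this
    exact hi this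
  · simp

/-- the element T -/
noncomputable def eT (H : Polynomial k) (q : ℕ) (V : Fin 3 → MvPolynomial (Fin 3) k) :
    MvPolynomial (Fin 3) k := aeval ![V 0, V 1] (hz H q) + (V 0) ^ (q - 1) * V 2

/-- the element P -/
noncomputable def eP (H : Polynomial k) (c : ℕ → k) (p q : ℕ)
    (V : Fin 3 → MvPolynomial (Fin 3) k) : MvPolynomial (Fin 3) k :=
  (eT H q V) ^ p + (∑ i ∈ Finset.Icc 1 (p - 1), C (c i) * (V 0) ^ (i * q) * (eT H q V) ^ (p - i))
        + C (c p) * (V 0) ^ (p * q - 1) * V 1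

theorem eT_eq (H : Polynomial k) (q : ℕ) (V : Fin 3 → MvPolynomial (Fin 3) k) :
    eT H q V = (∑ i ∈ Finset.range (q + 1), C (H.coeff i) * V 0 ^ (q - i) * V 1 ^ i) +
      (V 0) ^ (q - 1) * V 2 := by
  rw [eT, hz]
  simp [algebraMap_eq]

theorem eT_map (σ : MvPolynomial (Fin 3) k ≃ₐ[k] MvPolynomial (Fin 3) k) (H : Polynomial k) (q : ℕ)
    (V : Fin 3 → MvPolynomial (Fin 3) k) : σ (eT H q V) = eT H q (fun i => σ (V i)) := by
  rw [eT_eq, eT_eq]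
  simp only [map_add, map_sum, map_mul, map_pow]
  simp only [← algebraMap_eq, AlgEquiv.commutes]

theorem eP_map (σ : MvPolynomial (Fin 3) k ≃ₐ[k] MvPolynomial (Fin 3) k) (H : Polynomial k)
    (c : ℕ → k) (p q : ℕ)
    (V : Fin 3 → MvPolynomial (Fin 3) k) : σ (eP H c p q V) = eP H c p q (fun i => σ (V i)) := by
  rw [eP, eP]
  simp only [map_add, map_sum, map_mul, map_pow, eT_map]
  simp only [← algebraMap_eq, AlgEquiv.commutes]

/-- intermediate normal form -/
def PreNF (D : Derivation k (MvPolynomial (Fin 3) k) (MvPolynomial (Fin 3) k)) (p q : ℕ)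
    (V : Fin 3 → MvPolynomial (Fin 3) k) : Prop :=
  ∃ (H : Polynomial k) (c : ℕ → k) (κ : k), H.coeff q = 1 ∧ c p ≠ 0 ∧ κ ≠ 0 ∧ D (V 0) = 0 ∧
    D (eT H q V) = C κ * V 0 ^ (p * q + q - 2) ∧ D (eP H c p q V) = 0

theorem PreNF_conj {D : Derivation k (MvPolynomial (Fin 3) k) (MvPolynomial (Fin 3) k)} {p q : ℕ}
    {V : Fin 3 → MvPolynomial (Fin 3) k}
    (σ : MvPolynomial (Fin 3) k ≃ₐ[k] MvPolynomial (Fin 3) k)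
    (h : PreNF (conj σ.symm D) p q V) : PreNF D p q (fun i => σ (V i)) := by
  obtain ⟨H, c, κ, h1, h2, h3, h4, h5, h6⟩ := h
  have key : ∀ f, D (σ f) = σ (conj σ.symm D f) := by
    intro f
    rw [conj_apply, AlgEquiv.symm_symm, AlgEquiv.apply_symm_apply]
  refine ⟨H, c, κ, h1, h2, h3, ?_, ?_, ?_⟩
  · rw [key, h4, map_zero]
  · rw [← eT_map, key, h5, map_mul, map_pow, ← algebraMap_eq, AlgEquiv.commutes]
  · rw [← eP_map, key, h6, map_zero]

theorem eT_hom (H : Polynomial k) {q : ℕ} (hq : 1 ≤ q) {V : Fin 3 → MvPolynomial (Fin 3) k}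
    (hV : ∀ i, (V i).IsHomogeneous 1) : (eT H q V).IsHomogeneous q := by
  refine IsHomogeneous.add ?_ ?_
  · have := (hz_hom H q).aeval ![V 0, V 1] (n := 1) (by
      intro i; fin_cases i
      · exact hV 0
      · exact hV 1)
    rwa [one_mul] at this
  · have := ((hV 0).pow (q - 1)).mul (hV 2)
    have e : 1 * (q - 1) + 1 = q := by omega
    rwa [e] at this

theorem eP_hom (H : Polynomial k) (c : ℕ → k) {p q : ℕ} (hp : 1 ≤ p) (hq : 1 ≤ q)
    {V : Fin 3 → MvPolynomial (Fin 3) k}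
    (hV : ∀ i, (V i).IsHomogeneous 1) : (eP H c p q V).IsHomogeneous (p * q) := by
  have hT := eT_hom H hq hV
  refine IsHomogeneous.add (IsHomogeneous.add ?_ ?_) ?_
  · have := hT.pow p
    rwa [mul_comm] at this
  · refine IsHomogeneous.sum _ _ _ fun i hi => ?_
    rw [Finset.mem_Icc] at hi
    have := ((isHomogeneous_C (Fin 3) (c i)).mul ((hV 0).pow (i * q))).mul (hT.pow (p - i))
    have e : 0 + 1 * (i * q) + q * (p - i) = p * q := by
      obtain ⟨j, rfl⟩ : ∃ j, p = i + j := ⟨p - i, by omega⟩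
      rw [Nat.add_sub_cancel_left]; ring
    rwa [e] at this
  · have h' := ((isHomogeneous_C (Fin 3) (c p)).mul ((hV 0).pow (p * q - 1))).mul (hV 1)
    have : 1 ≤ p * q := Nat.mul_pos hp hq
    have e : 0 + 1 * (p * q - 1) + 1 = p * q := by omega
    rwa [e] at h'

theorem aeval_hz {A : Type*} [CommRing A] [Algebra k A] {H : Polynomial k} {n : ℕ}
    (h : H.natDegree ≤ n) (x : A) : aeval ![1, x] (hz H n) = Polynomial.aeval x H := by
  rw [hz, Polynomial.aeval_eq_sum_range' (Nat.lt_succ_of_le h)]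
  simp [Algebra.smul_def]

theorem dh_eT {H : Polynomial k} {q : ℕ} (h : H.natDegree ≤ q)
    {V : Fin 3 → MvPolynomial (Fin 3) k} (h0 : V 0 = X 0) :
    dh (eT H q V) = dh (V 2) + Polynomial.aeval (dh (V 1)) H := by
  have := aeval_hz h (dh (V 1))
  rw [← this, eT_eq, map_add, map_mul, map_pow, h0, dh_X0, one_pow, one_mul, add_comm]
  congr 1
  rw [hz]
  simp [dh_X0, dh_C, algebraMap_eq]

theorem sum_refl {A : Type*} [CommRing A] [Algebra k A] {F : Polynomial k} {p : ℕ} (hp : 1 ≤ p)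
    (hF : F.Monic) (hd : F.natDegree = p) (h0 : F.coeff 0 = 0) (t : A) :
    Polynomial.aeval t F = t ^ p +
      ∑ i ∈ Finset.Icc 1 (p - 1), algebraMap k A (F.coeff (p - i)) * t ^ (p - i) := by
  have hc : F.coeff p = 1 := by rw [← hd]; exact hF
  rw [Polynomial.aeval_eq_sum_range, hd, Finset.sum_range_succ, hc, one_smul, add_comm]
  congr 1
  obtain ⟨r, rfl⟩ : ∃ r, p = r + 1 := ⟨p - 1, by omega⟩
  rw [Finset.sum_range_succ', h0, zero_smul, add_zero]
  refine Finset.sum_nbij' (fun i => r - i) (fun i => r - i) ?_ ?_ ?_ ?_ ?_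
  · intro i hi; simp only [Finset.mem_range, Finset.mem_Icc] at *; omega
  · intro i hi; simp only [Finset.mem_range, Finset.mem_Icc] at *; omega
  · intro i hi; simp only [Finset.mem_range] at *; omega
  · intro i hi; simp only [Finset.mem_Icc] at *; omega
  · intro i hi
    simp only [Finset.mem_range] at hi
    rw [show r + 1 - (r - i) = i + 1 by omega, Algebra.smul_def]

theorem PreNF_of_NN {D : Derivation k (MvPolynomial (Fin 3) k) (MvPolynomial (Fin 3) k)} {p q : ℕ}
    (hp : 2 ≤ p) (hq : 2 ≤ q) (h0 : D (X 0) = 0) (hD : IsHomogDer D (p * q - 2))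
    {V : Fin 3 → MvPolynomial (Fin 3) k} (hV : ∀ i, (V i).IsHomogeneous 1) (hV0 : V 0 = X 0)
    (h : NN p q (dD D) (dh (V 1)) (dh (V 2))) : PreNF D p q V := by
  obtain ⟨H, F, α, κ, h1, h2, h3, h4, h5, h6, h7, h8, h9⟩ := h
  have hpq : 4 ≤ p * q := Nat.mul_le_mul hp hq
  have hc : H.coeff q = 1 := by rw [← h2]; exact h1
  refine ⟨H, fun i => if i = p then α else F.coeff (p - i), κ, hc, by simpa using h6, h7,
    by rw [hV0, h0], ?_, ?_⟩
  · have e := hD _ _ (eT_hom H (q := q) (by omega) hV)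
    have e1 : q + (p * q - 2) = p * q + q - 2 := by omega
    rw [e1] at e
    refine dh_inj e ?_ ?_
    · have := (isHomogeneous_C (Fin 3) κ).mul ((hV 0).pow (p * q + q - 2))
      rwa [zero_add, one_mul] at this
    · rw [← dD_dh h0, dh_eT h2.le hV0, h8, map_mul, map_pow, hV0, dh_X0, one_pow, mul_one, dh_C]
  · refine dh_inj0 (hD _ _ (eP_hom H _ (p := p) (q := q) (by omega) (by omega) hV)) ?_
    rw [← dD_dh h0, ← h9]
    congr 1
    rw [sum_refl (by omega) h3 h4 h5, eP]
    simp only [map_add, map_sum, map_mul, map_pow, dh_eT h2.le hV0, hV0, dh_X0, one_pow, mul_one,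
      dh_C, if_true]
    rw [add_comm]
    refine congrArg₂ _ rfl (congrArg₂ _ rfl ?_)
    refine Finset.sum_congr rfl fun i hi => ?_
    rw [Finset.mem_Icc] at hi
    have hne : ¬ (i = p) := by omega
    rw [if_neg hne, algebraMap_eq]

end Pre

open MvPolynomial

section Red
variable {k : Type*} [Field k]

theorem natDegree_bound {a b : k} (hab : ¬ (a = 0 ∧ b = 0)) {g : Polynomial k} {n : ℕ}
    (h : Le 1 1 n (Polynomial.aeval (C a * X 0 + C b * X 1 : MvPolynomial (Fin 2) k) g)) :
    g.natDegree ≤ n := by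
  obtain ⟨α, β, hαβ⟩ : ∃ α β : k, a * α + b * β = 1 := by
    by_cases ha : a = 0
    · have hb : b ≠ 0 := fun hb => hab ⟨ha, hb⟩
      exact ⟨0, b⁻¹, by rw [mul_zero, zero_add, mul_inv_cancel₀ hb]⟩
    · exact ⟨a⁻¹, 0, by rw [mul_zero, add_zero, mul_inv_cancel₀ ha]⟩
  set φ : MvPolynomial (Fin 2) k →ₐ[k] Polynomial k :=
    aeval ![Polynomial.C α * Polynomial.X, Polynomial.C β * Polynomial.X] with hφ
  have e1 : φ (C a * X 0 + C b * X 1) = Polynomial.X := by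
    rw [map_add, map_mul, map_mul, hφ, aeval_X, aeval_X, aeval_C, aeval_C, Polynomial.algebraMap_eq]
    simp only [Matrix.cons_val_zero, Matrix.cons_val_one]
    rw [← mul_assoc, ← mul_assoc, ← add_mul, ← Polynomial.C_mul, ← Polynomial.C_mul,
      ← Polynomial.C_add, hαβ, Polynomial.C_1, one_mul]
  have e2 : φ (Polynomial.aeval (C a * X 0 + C b * X 1 : MvPolynomial (Fin 2) k) g) = g := by
    rw [← Polynomial.aeval_algHom_apply, e1, Polynomial.aeval_X_left_apply]
  rw [← e2, as_sum (Polynomial.aeval (C a * X 0 + C b * X 1 : MvPolynomial (Fin 2) k) g), map_sum]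
  refine Polynomial.natDegree_sum_le_of_forall_le _ _ fun m hm => ?_
  have h1 := h m (mem_support_iff.1 hm)
  simp only [wt] at h1
  rw [hφ, aeval_monomial, Finsupp.prod_fintype _ _ (by simp), Fin.prod_univ_two,
    Polynomial.algebraMap_eq]
  simp only [Matrix.cons_val_zero, Matrix.cons_val_one]
  refine (Polynomial.natDegree_C_mul_le _ _).trans ?_
  refine Polynomial.natDegree_mul_le.trans ?_
  have b1 : ∀ (s : k) (j : ℕ), ((Polynomial.C s * Polynomial.X) ^ j).natDegree ≤ j := by
    intro s j
    refine Polynomial.natDegree_pow_le.trans ?_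
    have : (Polynomial.C s * Polynomial.X).natDegree ≤ 1 := by
      simpa using Polynomial.natDegree_C_mul_X_pow_le s 1
    calc j * _ ≤ j * 1 := Nat.mul_le_mul_left _ this
      _ = j := mul_one j
  have := b1 α (m 0)
  have := b1 β (m 1)
  omega

theorem tri_conj {D : Derivation k (MvPolynomial (Fin 3) k) (MvPolynomial (Fin 3) k)}
    (σ : MvPolynomial (Fin 3) k ≃ₐ[k] MvPolynomial (Fin 3) k)
    (h : IsTriangularizable (conj σ.symm D)) : IsTriangularizable D := by
  obtain ⟨V, ⟨τ, hτ⟩, ⟨c, hc⟩, h1, h2⟩ := h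
  have key : ∀ f, D (σ f) = σ (conj σ.symm D f) := by
    intro f
    rw [conj_apply, AlgEquiv.symm_symm, AlgEquiv.apply_symm_apply]
  have mm : ∀ {S : Set (MvPolynomial (Fin 3) k)} {x}, x ∈ Algebra.adjoin k S →
      σ x ∈ Algebra.adjoin k (σ '' S) := by
    intro S x hx
    have := AlgHom.map_adjoin σ.toAlgHom S
    change σ.toAlgHom x ∈ Algebra.adjoin k (σ.toAlgHom '' S)
    rw [← this]
    exact Subalgebra.mem_map.2 ⟨x, hx, rfl⟩
  refine ⟨fun i => σ (V i), ⟨τ.trans σ, fun i => by simp [hτ]⟩, ⟨c, ?_⟩, ?_, ?_⟩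
  · rw [key, hc, ← algebraMap_eq, AlgEquiv.commutes]
  · have := mm h1
    rw [Set.image_singleton] at this
    rw [key]; exact this
  · have := mm h2
    rw [Set.image_pair] at this
    rw [key]; exact this

/-- block matrix -/
def bm (a b c e : k) : Matrix (Fin 3) (Fin 3) k := !![1, 0, 0; 0, a, b; 0, c, e]

theorem bm_det (a b c e : k) : (bm a b c e).det = a * e - b * c := by
  simp [bm, Matrix.det_fin_three]

theorem bm_0 (a b c e : k) : lin (bm a b c e) 0 = X 0 := by
  simp [bm, lin, Fin.sum_univ_three]

theorem bm_1 (a b c e : k) : dh (lin (bm a b c e) 1) = C a * X 0 + C b * X 1 := by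
  simp [bm, lin, Fin.sum_univ_three, dh_X1, dh_X2, dh_C]

theorem bm_2 (a b c e : k) : dh (lin (bm a b c e) 2) = C c * X 0 + C e * X 1 := by
  simp [bm, lin, Fin.sum_univ_three, dh_X1, dh_X2, dh_C]

theorem tri_of_TT {D : Derivation k (MvPolynomial (Fin 3) k) (MvPolynomial (Fin 3) k)} {m : ℕ}
    (h0 : D (X 0) = 0) (hD : IsHomogDer D m) {a b c e : k} (hne : a * e - b * c ≠ 0)
    (h : TT (dD D) (C a * X 0 + C b * X 1) (C c * X 0 + C e * X 1)) : IsTriangularizable D := by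
  obtain ⟨⟨r, hr⟩, g, hg⟩ := h
  have hV := lin_hom (bm a b c e)
  have hD1 := hD _ _ (hV 1)
  have hD2 := hD _ _ (hV 2)
  rw [← bm_1 a b c e, dD_dh h0] at hr
  rw [← bm_2 a b c e, dD_dh h0] at hg
  have hgd : g.natDegree ≤ 1 + m := by
    apply natDegree_bound (a := a) (b := b)
    · rintro ⟨rfl, rfl⟩; simp at hne
    · rw [← hg]; exact dh_Le hD2
  have e1 : D (lin (bm a b c e) 1) = C r * X 0 ^ (1 + m) := by
    refine dh_inj hD1 ?_ ?_
    · have := (isHomogeneous_C (Fin 3) r).mul (X0_hom_pow (k := k) (1 + m))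
      rwa [zero_add] at this
    · rw [hr, map_mul, map_pow, dh_X0, one_pow, mul_one, dh_C]
  have e2 : D (lin (bm a b c e) 2) = aeval ![X 0, lin (bm a b c e) 1] (hz g (1 + m)) := by
    refine dh_inj hD2 ?_ ?_
    · have := (hz_hom g (1 + m)).aeval ![X 0, lin (bm a b c e) 1] (n := 1) (by
        intro i; fin_cases i
        · exact isHomogeneous_X k _
        · exact hV 1)
      rwa [one_mul] at this
    · rw [hg, ← bm_1 a b c e, ← aeval_hz hgd, hz]
      simp [dh_X0, algebraMap_eq]
  refine ⟨lin (bm a b c e), lin_coord _ (by rw [bm_det]; exact isUnit_iff_ne_zero.2 hne),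
    ⟨0, by rw [bm_0, h0, C_0]⟩, ?_, ?_⟩
  · rw [e1, bm_0, ← algebraMap_eq]
    exact mul_mem (Subalgebra.algebraMap_mem _ _)
      (pow_mem (Algebra.subset_adjoin (Set.mem_singleton _)) _)
  · rw [e2, bm_0, hz, map_sum]
    refine sum_mem fun i _ => ?_
    simp only [map_mul, map_pow, aeval_X, aeval_C, Matrix.cons_val_zero, Matrix.cons_val_one]
    exact mul_mem (mul_mem (Subalgebra.algebraMap_mem _ _)
      (pow_mem (Algebra.subset_adjoin (Set.mem_insert _ _)) _))
      (pow_mem (Algebra.subset_adjoin (Set.mem_insert_of_mem _ (Set.mem_singleton _))) _)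

theorem thmB0 [CharZero k] [IsAlgClosed k] {p q : ℕ} (hp : p.Prime) (hq : q.Prime)
    {D : Derivation k (MvPolynomial (Fin 3) k) (MvPolynomial (Fin 3) k)}
    (hlnd : IsLND D) (hirr : IsIrred D)
    (hhom : IsHomogDer D (p * q - 2)) (hntri : ¬ IsTriangularizable D) (h0 : D (X 0) = 0) :
    ∃ M : Matrix (Fin 3) (Fin 3) k, M.det = 1 ∧ (PreNF D p q (lin M) ∨ PreNF D q p (lin M)) := by
  have hpq : 4 ≤ p * q := Nat.mul_le_mul hp.two_le hq.two_le
  have c1 : dD D (X 0) = dh (D (X 1)) := by rw [← dh_X1, dD_dh h0]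
  have c2 : dD D (X 1) = dh (D (X 2)) := by rw [← dh_X2, dD_dh h0]
  have hD1 := hhom _ _ (isHomogeneous_X k (1 : Fin 3))
  have hD2 := hhom _ _ (isHomogeneous_X k (2 : Fin 3))
  have n1 : ((1 + (p * q - 2) : ℕ) : ℤ) = ((p * q : ℕ) : ℤ) - 1 := by omega
  have n2 : ((p * q - 2 : ℕ) : ℤ) = ((p * q : ℕ) : ℤ) - 2 := by omega
  obtain ⟨a, b, c, e, h⟩ := thmA2 (dD_lnd h0 hlnd) (dD_irred h0 hirr hhom) hp hq
    (by rw [c1, ← n1]; exact dh_Le hD1) (by rw [c2, ← n1]; exact dh_Le hD2)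
    (by
      rintro ⟨l1, l2⟩
      rw [c1, ← n2] at l1
      rw [c2, ← n2] at l2
      rw [add_comm] at hD1 hD2
      exact X0_not_unit (not_dvd_both h0 hirr (X0_dvd hD1 l1) (X0_dvd hD2 l2)))
  rcases h with ⟨hne, h⟩ | ⟨hd, h⟩
  · exact absurd (tri_of_TT h0 hhom hne h) hntri
  · refine ⟨bm a b c e, by rw [bm_det, hd], ?_⟩
    rw [← bm_1 a b c e, ← bm_2 a b c e] at h
    rcases h with h | h
    · exact Or.inl (PreNF_of_NN hp.two_le hq.two_le h0 hhom (lin_hom _) (bm_0 _ _ _ _) h)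
    · rw [mul_comm] at hhom
      exact Or.inr (PreNF_of_NN hq.two_le hp.two_le h0 hhom (lin_hom _) (bm_0 _ _ _ _) h)

theorem thmB [CharZero k] [IsAlgClosed k] {p q : ℕ} (hp : p.Prime) (hq : q.Prime)
    {D : Derivation k (MvPolynomial (Fin 3) k) (MvPolynomial (Fin 3) k)}
    (hlnd : IsLND D) (hirr : IsIrred D) (hrank : HasRank2 D)
    (hhom : IsHomogDer D (p * q - 2)) (hntri : ¬ IsTriangularizable D) :
    ∃ M : Matrix (Fin 3) (Fin 3) k, M.det = 1 ∧ (PreNF D p q (lin M) ∨ PreNF D q p (lin M)) := by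
  obtain ⟨⟨V, hV, hV2⟩, -⟩ := hrank
  obtain ⟨M, hM, hM0⟩ := exists_linear_ker hhom hV hV2
  have hu : IsUnit M.det := by rw [hM]; exact isUnit_one
  set σ := linE M hu with hσ
  obtain ⟨N, hN, h⟩ := thmB0 hp hq (conj_lnd σ.symm D hlnd) (conj_irred σ.symm D hirr)
    (homog_conj hhom M hu) (fun h => hntri (tri_conj σ h))
    (by rw [conj_apply, AlgEquiv.symm_symm, hσ, linE_X, hM0, map_zero])
  have e : (fun i => σ (lin N i)) = lin (N * M) := by
    funext i
    rw [hσ, linE_apply, aeval_lin]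
  refine ⟨N * M, by rw [Matrix.det_mul, hN, hM, one_mul], ?_⟩
  rw [← e]
  rcases h with h | h
  · exact Or.inl (PreNF_conj σ h)
  · exact Or.inr (PreNF_conj σ h)

end Red

section Fin
variable {k : Type*} [Field k]

/-- jacobian derivation -/
noncomputable def jacD (f g : MvPolynomial (Fin 3) k) :
    Derivation k (MvPolynomial (Fin 3) k) (MvPolynomial (Fin 3) k) :=
  (pderiv 1 f * pderiv 2 g - pderiv 2 f * pderiv 1 g) • pderiv 0 +
  (pderiv 2 f * pderiv 0 g - pderiv 0 f * pderiv 2 g) • pderiv 1 +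
  (pderiv 0 f * pderiv 1 g - pderiv 1 f * pderiv 0 g) • pderiv 2

theorem jacD_apply (f g h : MvPolynomial (Fin 3) k) : jacD f g h = jac f g h := by
  simp only [jacD, jac, Matrix.det_fin_three, Derivation.add_apply, Derivation.smul_apply,
    smul_eq_mul, Matrix.of_apply, Matrix.cons_val_zero, Matrix.cons_val_one, Matrix.cons_val_two,
    Matrix.head_cons, Matrix.tail_cons, Matrix.cons_val]
  ring

theorem jacD_l (f g : MvPolynomial (Fin 3) k) : jacD f g f = 0 := by
  simp only [jacD, Derivation.add_apply, Derivation.smul_apply, smul_eq_mul]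
  ring

theorem jacD_r (f g : MvPolynomial (Fin 3) k) : jacD f g g = 0 := by
  simp only [jacD, Derivation.add_apply, Derivation.smul_apply, smul_eq_mul]
  ring

theorem jacD_swap (f g h : MvPolynomial (Fin 3) k) : jacD f g h = - jacD f h g := by
  simp only [jacD, Derivation.add_apply, Derivation.smul_apply, smul_eq_mul]
  ring

theorem jacD_lin (M : Matrix (Fin 3) (Fin 3) k) :
    jacD (lin M 0) (lin M 1) (lin M 2) = C M.det := by
  have e : ∀ i j, pderiv j (lin M i) = C (M i j) := by
    intro i j
    simp only [lin, map_sum, Derivation.leibniz, derivation_C, mul_zero, add_zero, smul_eq_mul]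
    rw [Finset.sum_eq_single j]
    · rw [pderiv_X_self, mul_one]
    · intro l _ hl
      rw [pderiv_X_of_ne hl, mul_zero]
    · simp
  rw [Matrix.det_fin_three]
  simp only [jacD, Derivation.add_apply, Derivation.smul_apply, smul_eq_mul, e, C_add, C_sub, C_mul]
  ring

theorem der_const_mul {E : Derivation k (MvPolynomial (Fin 3) k) (MvPolynomial (Fin 3) k)}
    {c f : MvPolynomial (Fin 3) k} (hc : E c = 0) : E (c * f) = c * E f := by
  rw [Derivation.leibniz, hc, smul_zero, add_zero, smul_eq_mul]

theorem der_pow_zero {E : Derivation k (MvPolynomial (Fin 3) k) (MvPolynomial (Fin 3) k)}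
    {c : MvPolynomial (Fin 3) k} (hc : E c = 0) (n : ℕ) : E (c ^ n) = 0 := by
  rw [Derivation.leibniz_pow, hc, smul_zero, smul_zero]

theorem der_Cpow_zero {E : Derivation k (MvPolynomial (Fin 3) k) (MvPolynomial (Fin 3) k)}
    {c : MvPolynomial (Fin 3) k} (hc : E c = 0) (s : k) (n : ℕ) : E (C s * c ^ n) = 0 := by
  rw [der_const_mul (derivation_C E s), der_pow_zero hc, mul_zero]

variable {E : Derivation k (MvPolynomial (Fin 3) k) (MvPolynomial (Fin 3) k)}
  {H : Polynomial k} {c : ℕ → k} {p q : ℕ} {V : Fin 3 → MvPolynomial (Fin 3) k}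

theorem E_eP (h0 : E (V 0) = 0) (hT : E (eT H q V) = 0) :
    E (eP H c p q V) = C (c p) * V 0 ^ (p * q - 1) * E (V 1) := by
  rw [eP, map_add, map_add, der_pow_zero hT, zero_add, der_const_mul (der_Cpow_zero h0 _ _),
    map_sum, Finset.sum_eq_zero, zero_add]
  intro i _
  rw [der_const_mul (der_Cpow_zero h0 _ _), der_pow_zero hT, mul_zero]

theorem E_eT (h0 : E (V 0) = 0) (h1 : E (V 1) = 0) :
    E (eT H q V) = V 0 ^ (q - 1) * E (V 2) := by
  rw [eT_eq, map_add, der_const_mul (der_pow_zero h0 _), map_sum, Finset.sum_eq_zero, zero_add]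
  intro i _
  rw [der_const_mul (der_Cpow_zero h0 _ _), der_pow_zero h1, mul_zero]

theorem jac_PT : jacD (V 0) (eP H c p q V) (eT H q V) =
    C (c p) * V 0 ^ (p * q - 1) * (V 0 ^ (q - 1) * jacD (V 0) (V 1) (V 2)) := by
  rw [jacD_swap, E_eP (jacD_l _ _) (jacD_r _ _), jacD_swap, E_eT (jacD_l _ _) (jacD_r _ _)]
  ring

theorem eq_zero_of (hV : IsCoordSys V) (hc : c p ≠ 0) (h0 : E (V 0) = 0) (hT : E (eT H q V) = 0)
    (hP : E (eP H c p q V) = 0) (g : MvPolynomial (Fin 3) k) : E g = 0 := by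
  obtain ⟨σ, hσ⟩ := hV
  have hV0 : V 0 ≠ 0 := by
    rw [← hσ]
    exact (map_ne_zero_iff _ σ.injective).2 (X_ne_zero 0)
  have hcc : (C (c p) : MvPolynomial (Fin 3) k) ≠ 0 := by
    rw [Ne, C_eq_zero]; exact hc
  have h1 : E (V 1) = 0 := by
    rw [E_eP h0 hT] at hP
    exact (mul_eq_zero.1 hP).resolve_left (mul_ne_zero hcc (pow_ne_zero _ hV0))
  have h2 : E (V 2) = 0 := by
    rw [E_eT h0 h1] at hT
    exact (mul_eq_zero.1 hT).resolve_left (pow_ne_zero _ hV0)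
  have := chain E σ.toAlgHom (σ.symm g)
  have e : σ.toAlgHom (σ.symm g) = g := σ.apply_symm_apply g
  rw [e] at this
  rw [this]
  refine Finset.sum_eq_zero fun i _ => ?_
  have e2 : σ.toAlgHom (X i) = V i := hσ i
  rw [e2]
  fin_cases i
  · simp [h0]
  · simp [h1]
  · simp [h2]

theorem final [CharZero k] {D : Derivation k (MvPolynomial (Fin 3) k) (MvPolynomial (Fin 3) k)}
    (hlnd : IsLND D) (hp : 2 ≤ p) (hq : 2 ≤ q)
    {M : Matrix (Fin 3) (Fin 3) k} (hM : M.det = 1) (h : PreNF D p q (lin M)) :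
    ∃ γ : k, γ ≠ 0 ∧ NormalForm D γ p q (lin M) := by
  obtain ⟨H, c, κ, hH, hc, hκ, h0, hT, hP⟩ := h
  have hpq : 4 ≤ p * q := Nat.mul_le_mul hp hq
  have hV : IsCoordSys (lin M) := lin_coord M (by rw [hM]; exact isUnit_one)
  have hVne : ∀ i, lin M i ≠ 0 := by
    obtain ⟨σ, hσ⟩ := hV
    intro i
    rw [← hσ]
    exact (map_ne_zero_iff _ σ.injective).2 (X_ne_zero i)
  have hT' : D (eT H q (lin M)) = C (κ / c p * c p) * lin M 0 ^ (p * q + q - 2) := by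
    rw [hT, div_mul_cancel₀ _ hc]
  have hn0 : ndeg D (lin M 0) 0 := (ndeg_zero_iff D).2 ⟨hVne 0, h0⟩
  have hnC : ∀ s : k, s ≠ 0 → ndeg D (C s) 0 := fun s hs =>
    (ndeg_zero_iff D).2 ⟨by rw [Ne, C_eq_zero]; exact hs, derivation_C D s⟩
  have hn0p : ∀ n, ndeg D (lin M 0 ^ n) 0 := fun n => by
    have := ndeg_pow D hn0 n
    rwa [mul_zero] at this
  have hnT : ndeg D (eT H q (lin M)) 1 := by
    constructor
    · rw [Function.iterate_one, hT]
      exact mul_ne_zero (by rw [Ne, C_eq_zero]; exact hκ) (pow_ne_zero _ (hVne 0))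
    · rw [Function.iterate_succ_apply, Function.iterate_one, hT, der_Cpow_zero h0]
  have hn1 : ndeg D (lin M 1) p := by
    obtain ⟨n, hn⟩ := ndeg_exists D hlnd (hVne 1)
    have e1 := ndeg_mul D (ndeg_mul D (hnC _ hc) (hn0p (p * q - 1))) hn
    have e2 : C (c p) * lin M 0 ^ (p * q - 1) * lin M 1 = -((eT H q (lin M)) ^ p +
        ((∑ i ∈ Finset.Icc 1 (p - 1), C (c i) * (lin M 0) ^ (i * q) * (eT H q (lin M)) ^ (p - i)) -
          eP H c p q (lin M))) := by
      rw [eP]; ring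
    have e3 := ndeg_pow D hnT p
    rw [mul_one] at e3
    have e4 : ndeg D (C (c p) * lin M 0 ^ (p * q - 1) * lin M 1) p := by
      rw [e2]
      refine ndeg_neg D (ndeg_add D e3 ?_)
      rw [sub_eq_add_neg, it_add, it_sum]
      have : (⇑D)^[p] (-eP H c p q (lin M)) = 0 :=
        it_ge D (m := 1) (by rw [Function.iterate_one, map_neg, hP, neg_zero]) (by omega)
      rw [this, add_zero]
      refine Finset.sum_eq_zero fun i hi => ?_
      rw [Finset.mem_Icc] at hi
      rw [it_const_mul D (der_Cpow_zero h0 _ _)]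
      have e5 := (ndeg_pow D hnT (p - i)).2
      rw [it_ge D e5 (by omega), mul_zero]
    have := ndeg_unique D e1 e4
    rw [zero_add, zero_add] at this
    rwa [this] at hn
  have hn2 : ndeg D (lin M 2) (p * q) := by
    obtain ⟨n, hn⟩ := ndeg_exists D hlnd (hVne 2)
    have e1 := ndeg_mul D (hn0p (q - 1)) hn
    have e2 : lin M 0 ^ (q - 1) * lin M 2 = -(lin M 1 ^ q + ((∑ i ∈ Finset.range q,
        C (H.coeff i) * lin M 0 ^ (q - i) * lin M 1 ^ i) - eT H q (lin M))) := by
      rw [eT_eq, Finset.sum_range_succ, hH, C_1, Nat.sub_self, pow_zero]; ring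
    have e3 := ndeg_pow D hn1 q
    rw [mul_comm] at e3
    have e4 : ndeg D (lin M 0 ^ (q - 1) * lin M 2) (p * q) := by
      rw [e2]
      refine ndeg_neg D (ndeg_add D e3 ?_)
      rw [sub_eq_add_neg, it_add, it_sum]
      have : (⇑D)^[p * q] (-eT H q (lin M)) = 0 :=
        it_ge D (ndeg_neg D hnT).2 (by omega)
      rw [this, add_zero]
      refine Finset.sum_eq_zero fun i hi => ?_
      rw [Finset.mem_range] at hi
      rw [it_const_mul D (der_Cpow_zero h0 _ _)]
      have e5 := (ndeg_pow D hn1 i).2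
      have : (i + 1) * p ≤ q * p := Nat.mul_le_mul_right _ hi
      rw [it_ge D e5 (by rw [mul_comm p q]; rw [add_mul] at this; omega), mul_zero]
    have := ndeg_unique D e1 e4
    rw [zero_add] at this
    rwa [this] at hn
  refine ⟨κ / c p, div_ne_zero hκ hc, hz H q, c, hz_hom H q, by rw [hz_coeff, hH], hc, ?_, h0, hn1,
    hn2, hT'⟩
  intro g
  have hj := jac_PT (H := H) (c := c) (p := p) (q := q) (V := lin M)
  have key := eq_zero_of (E := D - (C (κ / c p) : MvPolynomial (Fin 3) k) •
    jacD (lin M 0) (eP H c p q (lin M))) (H := H) (c := c) (p := p) (q := q) hV hc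
    (by rw [Derivation.sub_apply, Derivation.smul_apply, jacD_l, h0, smul_zero, sub_zero])
    (by
      rw [Derivation.sub_apply, Derivation.smul_apply, hj, hT', jacD_lin, hM, C_1, smul_eq_mul,
        C_mul, show p * q + q - 2 = (p * q - 1) + (q - 1) by omega, pow_add]
      ring)
    (by rw [Derivation.sub_apply, Derivation.smul_apply, jacD_r, hP, smul_zero, sub_zero]) g
  rw [Derivation.sub_apply, Derivation.smul_apply, sub_eq_zero, jacD_apply, smul_eq_mul] at key
  exact key

end Fin

/-- Structure of irreducible homogeneous non-triangularizable LNDs of rank 2 and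
degree `pq - 2` over an algebraically closed field: they are of the normal form
above, possibly with the roles of `p` and `q` interchanged. -/
theorem structure_non_triangularizable {k : Type*} [Field k] [CharZero k]
    [IsAlgClosed k] (p q : ℕ) (hp : p.Prime) (hq : q.Prime)
    (D : Derivation k (MvPolynomial (Fin 3) k) (MvPolynomial (Fin 3) k))
    (hlnd : IsLND D) (hirr : IsIrred D) (hrank : HasRank2 D)
    (hhom : IsHomogDer D (p * q - 2)) (hntri : ¬ IsTriangularizable D) :
    ∃ V : Fin 3 → MvPolynomial (Fin 3) k, IsCoordSys V ∧
      (∀ i, (V i).IsHomogeneous 1) ∧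
      ∃ γ : k, γ ≠ 0 ∧ (NormalForm D γ p q V ∨ NormalForm D γ q p V) := by
  obtain ⟨M, hM, h⟩ := thmB hp hq hlnd hirr hrank hhom hntri
  refine ⟨lin M, lin_coord M (by rw [hM]; exact isUnit_one), lin_hom M, ?_⟩
  rcases h with h | h
  · obtain ⟨γ, hγ, h'⟩ := final hlnd hp.two_le hq.two_le hM h
    exact ⟨γ, hγ, Or.inl h'⟩
  · obtain ⟨γ, hγ, h'⟩ := final hlnd hq.two_le hp.two_le hM h
    exact ⟨γ, hγ, Or.inr h'⟩
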